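/- arXiv:1102.1349 — 10 statements merged into one kernel-verified Lean document; each statement's English description precedes it below -/
import Mathlib

section
/- Let β > −1 with β ≠ 0 and let τ ∈ ℝ. The set of entire functions f : ℂ → ℂ satisfying z² f'''(z) + 2(β+1) z f''(z) + (β² + β − τz) f'(z) + (z − τβ) f(z) = 0 for all z ∈ ℂ is a one-dimensional complex vector space. -/
open Filter Topology Nat

/-- The function `f` is the sum of the everywhere convergent power series `∑ aₙ zⁿ`. -/
def IsPowerSeriesSum (a : ℕ → ℂ) (f : ℂ → ℂ) : Prop :=
  ∀ z : ℂ, HasSum (fun n ↦ a n * z ^ n) (f z)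

namespace IsPowerSeriesSum

variable {a b : ℕ → ℂ} {f g : ℂ → ℂ}

theorem hasFPowerSeriesAt (h : IsPowerSeriesSum a f) :
    HasFPowerSeriesAt f (FormalMultilinearSeries.ofScalars ℂ a) 0 := by
  rw [hasFPowerSeriesAt_iff']
  refine Eventually.of_forall fun z ↦ ?_
  simpa [FormalMultilinearSeries.coeff_ofScalars, mul_comm] using h z

theorem coeff_unique (ha : IsPowerSeriesSum a f) (hb : IsPowerSeriesSum b f) : a = b :=
  FormalMultilinearSeries.ofScalars_series_injective ℂ ℂ
    (ha.hasFPowerSeriesAt.eq_formalMultilinearSeries hb.hasFPowerSeriesAt)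

theorem differentiable (h : IsPowerSeriesSum a f) : Differentiable ℂ f := by
  have hr : (FormalMultilinearSeries.ofScalars ℂ a).radius = ⊤ := by
    refine FormalMultilinearSeries.radius_eq_top_of_summable_norm _ fun r ↦ ?_
    simpa [FormalMultilinearSeries.ofScalars_norm] using (h (r : ℝ)).summable.norm
  have hf : HasFPowerSeriesOnBall f (FormalMultilinearSeries.ofScalars ℂ a) 0 ⊤ := by
    refine ⟨hr.ge, ENNReal.coe_lt_top, fun {y} _ ↦ ?_⟩
    simpa [FormalMultilinearSeries.ofScalars_apply_eq, mul_comm] using h y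
  intro z
  exact (hf.analyticAt_of_mem (by simp)).differentiableAt

theorem of_differentiable (hf : Differentiable ℂ f) :
    IsPowerSeriesSum (fun n ↦ (n ! : ℂ)⁻¹ * iteratedDeriv n f 0) f := by
  intro z
  convert! Complex.hasSum_taylorSeries_of_entire hf 0 z using 2 with n
  simp only [sub_zero, smul_eq_mul]
  ring

theorem deriv (h : IsPowerSeriesSum a f) :
    IsPowerSeriesSum (fun n ↦ (n + 1) * a (n + 1)) (deriv f) := by
  have hf := h.differentiable
  obtain rfl := h.coeff_unique (of_differentiable hf)
  have hd := of_differentiable (f := _root_.deriv f) fun z ↦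
    (hf.analyticAt z).deriv.differentiableAt
  convert hd using 2 with n
  beta_reduce
  rw [iteratedDeriv_succ', Nat.factorial_succ]
  push_cast
  have h₁ : (n : ℂ) + 1 ≠ 0 := Nat.cast_add_one_ne_zero n
  have h₂ : (n ! : ℂ) ≠ 0 := Nat.cast_ne_zero.mpr n.factorial_ne_zero
  field_simp

theorem id_mul (h : IsPowerSeriesSum a f) :
    IsPowerSeriesSum (fun n ↦ if n = 0 then 0 else a (n - 1)) (fun z ↦ z * f z) := by
  intro z
  rw [← hasSum_nat_add_iff' 1]
  convert! (h z).mul_left z using 1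
  · ext n
    simp only [Nat.add_one_ne_zero, if_false, Nat.add_sub_cancel]
    ring
  · simp

theorem add (ha : IsPowerSeriesSum a f) (hb : IsPowerSeriesSum b g) :
    IsPowerSeriesSum (fun n ↦ a n + b n) (fun z ↦ f z + g z) := by
  intro z
  simpa only [add_mul] using (ha z).add (hb z)

theorem const_mul (c : ℂ) (h : IsPowerSeriesSum a f) :
    IsPowerSeriesSum (fun n ↦ c * a n) (fun z ↦ c * f z) := by
  intro z
  simpa only [mul_assoc] using (h z).mul_left c

/-- The power series of the left-hand side of the differential equation. -/
theorem ode_lhs (β τ : ℂ) (h : IsPowerSeriesSum a f) :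
    IsPowerSeriesSum
      (fun n ↦ (n + 1) * (n + β) * (n + β + 1) * a (n + 1) - τ * (n + β) * a n
        + if n = 0 then 0 else a (n - 1))
      (fun z ↦ z ^ 2 * iteratedDeriv 3 f z + 2 * (β + 1) * z * iteratedDeriv 2 f z
        + (β ^ 2 + β - τ * z) * _root_.deriv f z + (z - τ * β) * f z) := by
  have h₁ := h.deriv
  have h₂ := h₁.deriv
  have h₃ := h₂.deriv
  have H := ((((h₃.id_mul.id_mul.add (h₂.id_mul.const_mul (2 * (β + 1)))).add
    (h₁.const_mul (β ^ 2 + β))).add (h₁.id_mul.const_mul (-τ))).add h.id_mul).add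
    (h.const_mul (-(τ * β)))
  convert H using 2 with n z
  · rcases n with _ | _ | n
    · simp
      ring
    · simp
      ring
    · simp
      ring
  · simp only [iteratedDeriv_succ', iteratedDeriv_zero]
    ring

end IsPowerSeriesSum

theorem exists_norm_le_mul_pow_of_recurrence {a p q : ℕ → ℂ}
    (ha : ∀ n, a (n + 2) = p n * a (n + 1) + q n * a n)
    (hp : Tendsto p atTop (𝓝 0)) (hq : Tendsto q atTop (𝓝 0)) {ε : ℝ} (hε : 0 < ε) :
    ∃ M N, ∀ n ≥ N, ‖a n‖ ≤ M * ε ^ n := by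
  have hp' : ∀ᶠ n in atTop, ‖p n‖ ≤ ε / 2 :=
    (tendsto_zero_iff_norm_tendsto_zero.mp hp).eventually_le_const (by positivity)
  have hq' : ∀ᶠ n in atTop, ‖q n‖ ≤ ε ^ 2 / 2 :=
    (tendsto_zero_iff_norm_tendsto_zero.mp hq).eventually_le_const (by positivity)
  obtain ⟨N, hN⟩ := eventually_atTop.mp (hp'.and hq')
  set M := max (‖a N‖ / ε ^ N) (‖a (N + 1)‖ / ε ^ (N + 1)) with hM
  have key : ∀ k, ‖a (N + k)‖ ≤ M * ε ^ (N + k) ∧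
      ‖a (N + k + 1)‖ ≤ M * ε ^ (N + k + 1) := by
    intro k
    induction k with
    | zero =>
      exact ⟨(div_le_iff₀ (by positivity)).mp (le_max_left _ _),
        (div_le_iff₀ (by positivity)).mp (le_max_right _ _)⟩
    | succ k ih =>
      refine ⟨ih.2, ?_⟩
      obtain ⟨h₁, h₂⟩ := hN (N + k) (by omega)
      calc ‖a (N + k + 2)‖ ≤ ‖p (N + k)‖ * ‖a (N + k + 1)‖ + ‖q (N + k)‖ * ‖a (N + k)‖ := by
            rw [ha, ← norm_mul, ← norm_mul]
            exact norm_add_le _ _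
        _ ≤ ε / 2 * (M * ε ^ (N + k + 1)) + ε ^ 2 / 2 * (M * ε ^ (N + k)) := by
            gcongr
            exacts [ih.2, ih.1]
        _ = M * ε ^ (N + k + 2) := by ring
  refine ⟨M, N, fun n hn ↦ ?_⟩
  obtain ⟨k, rfl⟩ := Nat.exists_eq_add_of_le hn
  exact (key k).1

theorem summable_mul_pow_of_recurrence {a p q : ℕ → ℂ}
    (ha : ∀ n, a (n + 2) = p n * a (n + 1) + q n * a n)
    (hp : Tendsto p atTop (𝓝 0)) (hq : Tendsto q atTop (𝓝 0)) (z : ℂ) :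
    Summable fun n ↦ a n * z ^ n := by
  have hz : 0 < ‖z‖ + 1 := by positivity
  obtain ⟨M, N, hMN⟩ :=
    exists_norm_le_mul_pow_of_recurrence ha hp hq (ε := (2 * (‖z‖ + 1))⁻¹) (by positivity)
  refine Summable.of_norm_bounded_eventually_nat (g := fun n ↦ M * (1 / 2) ^ n)
    (summable_geometric_two.mul_left M) (eventually_atTop.mpr ⟨N, fun n hn ↦ ?_⟩)
  rw [norm_mul, norm_pow]
  calc ‖a n‖ * ‖z‖ ^ n ≤ M * (2 * (‖z‖ + 1))⁻¹ ^ n * (‖z‖ + 1) ^ n := by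
        gcongr
        · exact (norm_nonneg _).trans (hMN n hn)
        · exact hMN n hn
        · linarith
    _ = M * (1 / 2) ^ n := by
        rw [mul_assoc, ← mul_pow]
        congr 2
        field_simp

/-- The Taylor coefficients of the entire solution taking the value `1` at `0`. -/
noncomputable def odeCoeff (β τ : ℝ) : ℕ → ℂ
  | 0 => 1
  | 1 => τ / (β + 1)
  | n + 2 => τ / ((n + 2) * (n + 2 + β)) * odeCoeff β τ (n + 1)
      + -1 / ((n + 2) * (n + 1 + β) * (n + 2 + β)) * odeCoeff β τ n

theorem tendsto_odeCoeff_recurrence_fst (β τ : ℝ) :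
    Tendsto (fun n : ℕ ↦ (τ : ℂ) / ((n + 2) * (n + 2 + β))) atTop (𝓝 0) := by
  have h : Tendsto (fun n : ℕ ↦ τ / (((n : ℝ) + 2) * (n + 2 + β))) atTop (𝓝 0) := by
    refine tendsto_const_nhds.div_atTop (Tendsto.atTop_mul_atTop₀ ?_ ?_)
    · exact tendsto_atTop_add_const_right _ _ tendsto_natCast_atTop_atTop
    · exact tendsto_atTop_add_const_right _ _
        (tendsto_atTop_add_const_right _ _ tendsto_natCast_atTop_atTop)
  have := (Complex.continuous_ofReal.tendsto 0).comp h
  simpa [Function.comp_def] using this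

theorem tendsto_odeCoeff_recurrence_snd (β : ℝ) :
    Tendsto (fun n : ℕ ↦ (-1 : ℂ) / ((n + 2) * (n + 1 + β) * (n + 2 + β))) atTop (𝓝 0) := by
  have h : Tendsto (fun n : ℕ ↦ -1 / (((n : ℝ) + 2) * (n + 1 + β) * (n + 2 + β)))
      atTop (𝓝 0) := by
    have hn (c : ℝ) : Tendsto (fun n : ℕ ↦ (n : ℝ) + c) atTop atTop :=
      tendsto_atTop_add_const_right _ _ tendsto_natCast_atTop_atTop
    exact tendsto_const_nhds.div_atTop
      (((hn 2).atTop_mul_atTop₀ (tendsto_atTop_add_const_right _ β (hn 1))).atTop_mul_atTop₀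
        (tendsto_atTop_add_const_right _ β (hn 2)))
  have := (Complex.continuous_ofReal.tendsto 0).comp h
  simpa [Function.comp_def] using this

theorem isPowerSeriesSum_odeCoeff (β τ : ℝ) :
    IsPowerSeriesSum (odeCoeff β τ) fun z ↦ ∑' n, odeCoeff β τ n * z ^ n := fun z ↦
  (summable_mul_pow_of_recurrence (fun _ ↦ rfl) (tendsto_odeCoeff_recurrence_fst β τ)
    (tendsto_odeCoeff_recurrence_snd β) z).hasSum

theorem natCast_add_one_add_ne_zero {β : ℝ} (hβ : -1 < β) (n : ℕ) : (n : ℂ) + 1 + β ≠ 0 := by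
  have h : (n : ℝ) + 1 + β ≠ 0 := by
    have : (0 : ℝ) ≤ n := n.cast_nonneg
    linarith
  exact_mod_cast h

theorem ode_recurrence_iff {β : ℝ} (τ : ℝ) (hβ : -1 < β) (hβ0 : β ≠ 0) (a : ℕ → ℂ) :
    (∀ n : ℕ, ((n : ℂ) + 1) * (n + β) * (n + β + 1) * a (n + 1) - τ * (n + β) * a n
        + (if n = 0 then 0 else a (n - 1)) = 0) ↔ ∀ n, a n = a 0 * odeCoeff β τ n := by
  have hβc : (β : ℂ) ≠ 0 := mod_cast hβ0
  have hβ1 : (β : ℂ) + 1 ≠ 0 := by simpa [add_comm] using natCast_add_one_add_ne_zero hβ 0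
  have hβn := natCast_add_one_add_ne_zero hβ
  have hβn' (n : ℕ) : (n : ℂ) + 2 + β ≠ 0 := by
    have := hβn (n + 1)
    push_cast at this
    convert this using 2
    ring
  have hn (n : ℕ) : (n : ℂ) + 2 ≠ 0 := by exact_mod_cast (show n + 2 ≠ 0 by omega)
  constructor
  · intro h n
    induction n using Nat.twoStepInduction with
    | zero => simp [odeCoeff]
    | one =>
      have h₀ : (β : ℂ) * ((β + 1) * a 1 - τ * a 0) = 0 := by
        have := h 0
        simp only [Nat.cast_zero, zero_add, if_true, add_zero] at this
        linear_combination this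
      rw [odeCoeff]
      field_simp
      linear_combination (mul_eq_zero.mp h₀).resolve_left hβc
    | more n ih₀ ih₁ =>
      have h₂ := h (n + 1)
      simp only [Nat.add_one_ne_zero, if_false, Nat.add_sub_cancel] at h₂
      push_cast at h₂
      rw [odeCoeff, mul_add, mul_left_comm, ← ih₁, mul_left_comm (a 0), ← ih₀]
      have h₃ := hn n
      have h₄ := hβn n
      have h₅ := hβn' n
      field_simp
      linear_combination h₂
  · intro h n
    rcases n with _ | n
    · rw [h 1, odeCoeff]
      simp
      field_simp
      ring
    · have h₃ := hn n
      have h₄ := hβn n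
      have h₅ := hβn' n
      simp only [Nat.add_one_ne_zero, if_false, Nat.add_sub_cancel]
      rw [h (n + 1 + 1), h (n + 1), h n, odeCoeff]
      push_cast
      field_simp
      ring

theorem IsPowerSeriesSum.ode_iff {β τ : ℝ} (hβ : -1 < β) (hβ0 : β ≠ 0) {a : ℕ → ℂ} {f : ℂ → ℂ}
    (h : IsPowerSeriesSum a f) :
    (∀ z : ℂ, z ^ 2 * iteratedDeriv 3 f z + 2 * ((β : ℂ) + 1) * z * iteratedDeriv 2 f z
        + ((β : ℂ) ^ 2 + (β : ℂ) - (τ : ℂ) * z) * _root_.deriv f z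
        + (z - (τ : ℂ) * (β : ℂ)) * f z = 0) ↔ ∀ n, a n = a 0 * odeCoeff β τ n := by
  rw [← ode_recurrence_iff τ hβ hβ0]
  have hL := h.ode_lhs β τ
  constructor
  · intro hf
    have h0 : IsPowerSeriesSum 0 0 := fun z ↦ by simp [hasSum_zero]
    exact congrFun (hL.coeff_unique ((funext hf : _ = (0 : ℂ → ℂ)) ▸ h0))
  · intro ha z
    have hz := hL z
    simp only [ha, zero_mul] at hz
    exact hz.unique hasSum_zero


/-- For `β > -1`, `β ≠ 0` and `τ ∈ ℝ`, the set of entire solutions of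
`z² f''' + 2(β+1) z f'' + (β² + β − τz) f' + (z − τβ) f = 0` is a one-dimensional
complex vector space: it is the span of a single nonzero function. -/
theorem entire_solutions_one_dimensional (β τ : ℝ) (hβ : -1 < β) (hβ0 : β ≠ 0) :
    ∃ g : ℂ → ℂ, g ≠ 0 ∧
      {f : ℂ → ℂ | Differentiable ℂ f ∧ ∀ z : ℂ,
          z ^ 2 * iteratedDeriv 3 f z
            + 2 * ((β : ℂ) + 1) * z * iteratedDeriv 2 f z
            + ((β : ℂ) ^ 2 + (β : ℂ) - (τ : ℂ) * z) * deriv f z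
            + (z - (τ : ℂ) * (β : ℂ)) * f z = 0}
        = (Submodule.span ℂ ({g} : Set (ℂ → ℂ)) : Set (ℂ → ℂ)) := by
  have hg := isPowerSeriesSum_odeCoeff β τ
  refine ⟨fun z ↦ ∑' n, odeCoeff β τ n * z ^ n, fun h0 ↦ ?_, Set.ext fun f ↦ ?_⟩
  rotate_left
  · rw [SetLike.mem_coe, Submodule.mem_span_singleton]
    constructor
    · rintro ⟨hf, hode⟩
      obtain ⟨a, ha⟩ : ∃ a, IsPowerSeriesSum a f := ⟨_, .of_differentiable hf⟩
      have hrec := (ha.ode_iff hβ hβ0).mp hode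
      refine ⟨a 0, funext fun z ↦ (hg.const_mul (a 0) z).unique ?_⟩
      simpa only [← hrec] using ha z
    · rintro ⟨c, rfl⟩
      have hc := hg.const_mul c
      exact ⟨hc.differentiable, (hc.ode_iff hβ hβ0).mpr fun n ↦ by simp [odeCoeff]⟩
  · have h1 := hg.coeff_unique (b := 0) fun z ↦ by simp [congrFun h0 z, hasSum_zero]
    simpa [odeCoeff] using congrFun h1 0
end

section
/- Let β = 0 and τ ∈ ℝ. The set of entire functions f : ℂ → ℂ satisfying z² f'''(z) + 2 z f''(z) − τz f'(z) + z f(z) = 0 for all z ∈ ℂ is a two-dimensional complex vector space. -/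
/-- The exponential generating function `∑ b n * z ^ n / n!`. -/
noncomputable def expGen (b : ℕ → ℂ) (z : ℂ) : ℂ := ∑' n, b n * (z ^ n / n.factorial)

/-- A sequence growing at most geometrically with ratio `R`. -/
def GeomBounded (R : ℝ) (b : ℕ → ℂ) : Prop := ∃ C, ∀ n, ‖b n‖ ≤ C * R ^ n

theorem GeomBounded.shift {R : ℝ} {b : ℕ → ℂ} (hb : GeomBounded R b) :
    GeomBounded R (fun n => b (n + 1)) := by
  obtain ⟨C, hC⟩ := hb
  exact ⟨C * R, fun n => (hC (n + 1)).trans_eq (by ring)⟩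

theorem GeomBounded.summable {R : ℝ} {b : ℕ → ℂ} (hb : GeomBounded R b) (z : ℂ) :
    Summable fun n => b n * (z ^ n / n.factorial) := by
  obtain ⟨C, hC⟩ := hb
  refine Summable.of_norm_bounded
    (g := fun n : ℕ => C * ((R * ‖z‖) ^ n / n.factorial))
    ((Real.summable_pow_div_factorial _).mul_left C) fun n => ?_
  rw [norm_mul, norm_div, norm_pow, Complex.norm_natCast, mul_pow]
  calc ‖b n‖ * (‖z‖ ^ n / n.factorial) ≤ C * R ^ n * (‖z‖ ^ n / n.factorial) := by
        gcongr
        exact hC n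
    _ = _ := by ring

theorem hasDerivAt_pow_succ_div_factorial (n : ℕ) (z : ℂ) :
    HasDerivAt (fun w : ℂ => w ^ (n + 1) / (n + 1).factorial) (z ^ n / n.factorial) z := by
  refine ((hasDerivAt_pow (n + 1) z).div_const ((n + 1).factorial : ℂ)).congr_deriv ?_
  have h₁ : (n.factorial : ℂ) ≠ 0 := by exact_mod_cast n.factorial_ne_zero
  have h₂ : ((n : ℂ) + 1) ≠ 0 := by exact_mod_cast n.succ_ne_zero
  rw [Nat.factorial_succ]
  push_cast
  field_simp

theorem expGen_zero (b : ℕ → ℂ) : expGen b 0 = b 0 := by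
  rw [expGen, tsum_eq_single 0]
  · simp
  · intro n hn
    simp [hn]

theorem GeomBounded.expGen_eq {R : ℝ} {b : ℕ → ℂ} (hb : GeomBounded R b) (z : ℂ) :
    expGen b z = b 0 + ∑' n, b (n + 1) * (z ^ (n + 1) / (n + 1).factorial) := by
  rw [expGen, (hb.summable z).tsum_eq_zero_add]
  simp

theorem GeomBounded.hasDerivAt_expGen {R : ℝ} {b : ℕ → ℂ} (hb : GeomBounded R b) (z : ℂ) :
    HasDerivAt (expGen b) (expGen (fun n => b (n + 1)) z) z := by
  have hfun : expGen b
      = fun w => b 0 + ∑' n, b (n + 1) * (w ^ (n + 1) / (n + 1).factorial) :=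
    funext hb.expGen_eq
  rw [hfun]
  refine HasDerivAt.const_add _ ?_
  have hs := (hb.shift.summable ((‖z‖ + 1 : ℝ) : ℂ)).norm
  refine hasDerivAt_tsum_of_isPreconnected (t := Metric.ball (0 : ℂ) (‖z‖ + 1)) (y₀ := 0)
    (g' := fun n w => b (n + 1) * (w ^ n / n.factorial)) hs
    Metric.isOpen_ball (convex_ball _ _).isPreconnected
    (fun n w _ => (hasDerivAt_pow_succ_div_factorial n w).const_mul _)
    (fun n w hw => ?_) (Metric.mem_ball_self (by positivity))
    ((summable_nat_add_iff 1).2 (hb.summable 0)) (by simp)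
  have hw' : ‖w‖ ≤ ‖z‖ + 1 := (mem_ball_zero_iff.1 hw).le
  have h0 : (0 : ℝ) ≤ ‖z‖ + 1 := by positivity
  rw [norm_mul, norm_mul, norm_div, norm_div, norm_pow, norm_pow, Complex.norm_real,
    Real.norm_of_nonneg h0]
  gcongr

theorem GeomBounded.iteratedDeriv_expGen {R : ℝ} {b : ℕ → ℂ} (hb : GeomBounded R b) (k : ℕ) :
    iteratedDeriv k (expGen b) = expGen (fun n => b (n + k)) := by
  induction k generalizing b with
  | zero => simp
  | succ k ih =>
    have hderiv : deriv (expGen b) = expGen (fun n => b (n + 1)) :=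
      funext fun z => (hb.hasDerivAt_expGen z).deriv
    rw [iteratedDeriv_succ', hderiv, ih hb.shift]
    simp only [add_assoc, add_comm, add_left_comm]

/-- The derivatives at the origin of the solution `f` with `f 0 = x` and `f' 0 = y`. -/
noncomputable def taylorDerivs (τ x y : ℂ) : ℕ → ℂ
  | 0 => x
  | 1 => y
  | n + 2 => (τ * taylorDerivs τ x y (n + 1) - taylorDerivs τ x y n) / (n + 2)

theorem taylorDerivs_rec (τ x y : ℂ) (n : ℕ) :
    (n + 2) * taylorDerivs τ x y (n + 2) - τ * taylorDerivs τ x y (n + 1)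
      + taylorDerivs τ x y n = 0 := by
  have h : (n : ℂ) + 2 ≠ 0 := by exact_mod_cast (n + 1).succ_ne_zero
  rw [taylorDerivs]
  field_simp
  ring

theorem taylorDerivs_unique {τ : ℂ} {b : ℕ → ℂ}
    (hb : ∀ n : ℕ, (n + 2) * b (n + 2) - τ * b (n + 1) + b n = 0) :
    b = taylorDerivs τ (b 0) (b 1) := by
  have key : ∀ n, b n = taylorDerivs τ (b 0) (b 1) n ∧
      b (n + 1) = taylorDerivs τ (b 0) (b 1) (n + 1) := by
    intro n
    induction n with
    | zero => exact ⟨rfl, rfl⟩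
    | succ n ih =>
      refine ⟨ih.2, ?_⟩
      have h : (n : ℂ) + 2 ≠ 0 := by exact_mod_cast (n + 1).succ_ne_zero
      rw [taylorDerivs, ← ih.1, ← ih.2, eq_div_iff h]
      linear_combination hb n
  exact funext fun n => (key n).1

theorem taylorDerivs_eq_add (τ x y : ℂ) (n : ℕ) :
    taylorDerivs τ x y n = x * taylorDerivs τ 1 0 n + y * taylorDerivs τ 0 1 n := by
  have h := taylorDerivs_unique (τ := τ)
    (b := fun n => x * taylorDerivs τ 1 0 n + y * taylorDerivs τ 0 1 n) fun n => by
      linear_combination x * taylorDerivs_rec τ 1 0 n + y * taylorDerivs_rec τ 0 1 n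
  simpa [taylorDerivs] using (congrFun h n).symm

theorem geomBounded_taylorDerivs (τ x y : ℂ) :
    GeomBounded (‖τ‖ + 1) (taylorDerivs τ x y) := by
  refine ⟨‖x‖ + ‖y‖, fun n => ?_⟩
  suffices key : ‖taylorDerivs τ x y n‖ ≤ (‖x‖ + ‖y‖) * (‖τ‖ + 1) ^ n ∧
      ‖taylorDerivs τ x y (n + 1)‖ ≤ (‖x‖ + ‖y‖) * (‖τ‖ + 1) ^ (n + 1) from key.1
  induction n with
  | zero =>
    simp only [taylorDerivs, pow_zero, mul_one, zero_add, pow_one]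
    exact ⟨by linarith [norm_nonneg y], by
      nlinarith [norm_nonneg x, norm_nonneg y, norm_nonneg τ,
        mul_nonneg (norm_nonneg x) (norm_nonneg τ), mul_nonneg (norm_nonneg y) (norm_nonneg τ)]⟩
  | succ n ih =>
    refine ⟨ih.2, ?_⟩
    have hden : (1 : ℝ) ≤ ‖(n : ℂ) + 2‖ := by
      have : ‖(n : ℂ) + 2‖ = n + 2 := by exact_mod_cast Complex.norm_natCast (n + 2)
      rw [this]
      linarith [Nat.cast_nonneg (α := ℝ) n]
    have hC : 0 ≤ (‖x‖ + ‖y‖) * (‖τ‖ + 1) ^ n := by positivity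
    rw [taylorDerivs, norm_div]
    refine (div_le_self (norm_nonneg _) hden).trans ?_
    calc ‖τ * taylorDerivs τ x y (n + 1) - taylorDerivs τ x y n‖
        ≤ ‖τ‖ * ‖taylorDerivs τ x y (n + 1)‖ + ‖taylorDerivs τ x y n‖ := by
          rw [← norm_mul]
          exact norm_sub_le _ _
      _ ≤ ‖τ‖ * ((‖x‖ + ‖y‖) * (‖τ‖ + 1) ^ (n + 1)) + (‖x‖ + ‖y‖) * (‖τ‖ + 1) ^ n := by
          gcongr
          exacts [ih.2, ih.1]
      _ ≤ (‖x‖ + ‖y‖) * (‖τ‖ + 1) ^ (n + 1 + 1) := by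
          have := mul_nonneg hC (norm_nonneg τ)
          rw [pow_succ _ (n + 1), pow_succ]
          nlinarith

theorem GeomBounded.mul_expGen_shift {R : ℝ} {b : ℕ → ℂ} (hb : GeomBounded R b) (z : ℂ) :
    HasSum (fun n : ℕ => n * b n * (z ^ n / n.factorial)) (z * expGen (fun n => b (n + 1)) z) := by
  have hterm : (fun n : ℕ => ((n + 1 : ℕ) : ℂ) * b (n + 1) * (z ^ (n + 1) / (n + 1).factorial))
      = fun n => z * (b (n + 1) * (z ^ n / n.factorial)) := by
    funext n
    have h₁ : (n.factorial : ℂ) ≠ 0 := by exact_mod_cast n.factorial_ne_zero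
    have h₂ : ((n : ℂ) + 1) ≠ 0 := by exact_mod_cast n.succ_ne_zero
    rw [Nat.factorial_succ]
    push_cast
    field_simp
    ring
  rw [← hasSum_nat_add_iff' 1, hterm]
  simp only [Finset.range_one, Finset.sum_singleton, Nat.cast_zero, zero_mul, sub_zero]
  exact (hb.shift.summable z).hasSum.mul_left z

theorem expGen_taylorDerivs_ode (τ x y z : ℂ) :
    z * iteratedDeriv 3 (expGen (taylorDerivs τ x y)) z
      + 2 * iteratedDeriv 2 (expGen (taylorDerivs τ x y)) z
      - τ * deriv (expGen (taylorDerivs τ x y)) z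
      + expGen (taylorDerivs τ x y) z = 0 := by
  have hb := geomBounded_taylorDerivs τ x y
  rw [hb.iteratedDeriv_expGen, hb.iteratedDeriv_expGen, (hb.hasDerivAt_expGen z).deriv]
  have h₃ := hb.shift.shift.mul_expGen_shift z
  have h₂ := (hb.shift.shift.summable z).hasSum.mul_left 2
  have h₁ := (hb.shift.summable z).hasSum.mul_left τ
  have h₀ := (hb.summable z).hasSum
  refine (((h₃.add h₂).sub h₁).add h₀).unique ?_
  convert hasSum_zero with n
  linear_combination (z ^ n / n.factorial) * taylorDerivs_rec τ x y n

theorem expGen_taylorDerivs_eq_add (τ x y : ℂ) :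
    expGen (taylorDerivs τ x y)
      = x • expGen (taylorDerivs τ 1 0) + y • expGen (taylorDerivs τ 0 1) := by
  funext z
  have h₁ := ((geomBounded_taylorDerivs τ 1 0).summable z).hasSum.mul_left x
  have h₂ := ((geomBounded_taylorDerivs τ 0 1).summable z).hasSum.mul_left y
  refine Eq.trans (tsum_congr fun n => ?_) (h₁.add h₂).tsum_eq
  rw [taylorDerivs_eq_add]
  ring

theorem hasDerivAt_iteratedDeriv {f : ℂ → ℂ} (hf : Differentiable ℂ f) (n : ℕ) (z : ℂ) :
    HasDerivAt (iteratedDeriv n f) (iteratedDeriv (n + 1) f z) z := by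
  rw [iteratedDeriv_succ]
  exact ((hf.contDiff (n := n + 1)).differentiable_iteratedDeriv n
    (by exact_mod_cast n.lt_succ_self) z).hasDerivAt

theorem iteratedDeriv_ode {τ : ℂ} {f : ℂ → ℂ} (hf : Differentiable ℂ f)
    (hode : ∀ z : ℂ, z ^ 2 * iteratedDeriv 3 f z + 2 * z * iteratedDeriv 2 f z
      - τ * z * deriv f z + z * f z = 0) (n : ℕ) (z : ℂ) :
    z * iteratedDeriv (n + 3) f z + (n + 2) * iteratedDeriv (n + 2) f z
      - τ * iteratedDeriv (n + 1) f z + iteratedDeriv n f z = 0 := by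
  induction n generalizing z with
  | zero =>
    have hcont : ∀ k, Continuous (iteratedDeriv k f) := fun k =>
      continuous_iff_continuousAt.2 fun w => (hasDerivAt_iteratedDeriv hf k w).continuousAt
    have h₃ := hcont 3
    have h₂ := hcont 2
    have h₁ := hcont 1
    have h₀ := hcont 0
    refine congrFun (Continuous.ext_on (dense_compl_singleton (0 : ℂ))
      (f := fun w => w * iteratedDeriv (0 + 3) f w
        + (((0 : ℕ) : ℂ) + 2) * iteratedDeriv (0 + 2) f w
        - τ * iteratedDeriv (0 + 1) f w + iteratedDeriv 0 f w) (g := fun _ => 0)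
      (by simp only [zero_add]; fun_prop) continuous_const fun w hw => ?_) z
    refine mul_left_cancel₀ (show w ≠ 0 from hw) ?_
    simp only [zero_add, iteratedDeriv_one, iteratedDeriv_zero, Nat.cast_zero]
    linear_combination hode w
  | succ n ih =>
    have h := ((((hasDerivAt_id z).mul (hasDerivAt_iteratedDeriv hf (n + 3) z)).add
      ((hasDerivAt_iteratedDeriv hf (n + 2) z).const_mul ((n : ℂ) + 2))).sub
      ((hasDerivAt_iteratedDeriv hf (n + 1) z).const_mul τ)).add
      (hasDerivAt_iteratedDeriv hf n z)
    have h0 := h.unique ((hasDerivAt_const z (0 : ℂ)).congr_of_eventuallyEq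
      (Filter.Eventually.of_forall ih))
    simp only [id] at h0
    rw [show n + 1 + 3 = n + 3 + 1 by ring, show n + 1 + 2 = n + 2 + 1 by ring]
    push_cast
    linear_combination h0

theorem eq_expGen_iteratedDeriv {f : ℂ → ℂ} (hf : Differentiable ℂ f) :
    f = expGen (fun n => iteratedDeriv n f 0) := by
  funext z
  rw [← Complex.taylorSeries_eq_of_entire' 0 z hf]
  refine tsum_congr fun n => ?_
  rw [sub_zero]
  ring

/-- For `β = 0` and `τ ∈ ℝ`, the set of entire solutions of
`z² f''' + 2 z f'' − τz f' + z f = 0` is a two-dimensional complex vector space: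
it is the span of two linearly independent functions. -/
theorem entire_solutions_two_dimensional (τ : ℝ) :
    ∃ g₁ g₂ : ℂ → ℂ, LinearIndependent ℂ ![g₁, g₂] ∧
      {f : ℂ → ℂ | Differentiable ℂ f ∧ ∀ z : ℂ,
          z ^ 2 * iteratedDeriv 3 f z
            + 2 * z * iteratedDeriv 2 f z
            - (τ : ℂ) * z * deriv f z
            + z * f z = 0}
        = (Submodule.span ℂ ({g₁, g₂} : Set (ℂ → ℂ)) : Set (ℂ → ℂ)) := by
  refine ⟨expGen (taylorDerivs τ 1 0), expGen (taylorDerivs τ 0 1), ?_, ?_⟩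
  · rw [LinearIndependent.pair_iff]
    intro x y h
    rw [← expGen_taylorDerivs_eq_add] at h
    have hd := ((geomBounded_taylorDerivs τ x y).hasDerivAt_expGen 0).deriv
    have h0 := congrFun h 0
    rw [expGen_zero] at h0
    rw [h, expGen_zero] at hd
    simp only [taylorDerivs, Pi.zero_apply] at h0 hd
    exact ⟨h0, by simpa using hd.symm⟩
  · ext f
    simp only [Set.mem_ofPred_eq, SetLike.mem_coe, Submodule.mem_span_pair,
      ← expGen_taylorDerivs_eq_add]
    constructor
    · rintro ⟨hf, hode⟩
      refine ⟨iteratedDeriv 0 f 0, iteratedDeriv 1 f 0, ?_⟩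
      rw [← taylorDerivs_unique (b := fun n => iteratedDeriv n f 0) fun n => ?_]
      · exact (eq_expGen_iteratedDeriv hf).symm
      · linear_combination iteratedDeriv_ode hf hode n 0
    · rintro ⟨x, y, rfl⟩
      refine ⟨fun z =>
        ((geomBounded_taylorDerivs τ x y).hasDerivAt_expGen z).differentiableAt, fun z => ?_⟩
      linear_combination z * expGen_taylorDerivs_ode τ x y z
end

section
/- Let β > −1 and τ ∈ ℝ, let U ⊆ ℂ \ (−∞, 0] be open, and let q : U → ℂ be holomorphic and satisfy z q'''(z) − β q''(z) − τ q'(z) + q(z) = 0 for all z ∈ U. Define Q(z) = z^{−β} q''(z) on U, where z^{−β} = exp(−β Log z) with the principal branch of the logarithm. Then Q satisfies z² Q'''(z) + 2(β+1) z Q''(z) + (β² + β − τz) Q'(z) + (z − τβ) Q(z) = 0 for all z ∈ U. -/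
/-- The product rule for `w ^ c * g w` on the slit plane. -/
theorem hasDerivAt_cpow_const_mul {c z g' : ℂ} {g : ℂ → ℂ} (hz : z ∈ Complex.slitPlane)
    (hg : HasDerivAt g g' z) :
    HasDerivAt (fun w => w ^ c * g w) (z ^ c * (c / z * g z + g')) z := by
  have hz0 : z ≠ 0 := Complex.slitPlane_ne_zero hz
  have h := ((hasDerivAt_id z).cpow_const (c := c) hz).mul hg
  refine h.congr_deriv ?_
  simp only [id, Complex.cpow_sub _ _ hz0, Complex.cpow_one]
  field_simp

/-- Derivatives of functions agreeing on an open set agree there. -/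
theorem IsOpen.hasDerivAt_congr {U : Set ℂ} (hU : IsOpen U) {f g : ℂ → ℂ} {g' z : ℂ}
    (hfg : Set.EqOn f g U) (hz : z ∈ U) (hg : HasDerivAt g g' z) : HasDerivAt f g' z :=
  hg.congr_of_eventuallyEq (hfg.eventuallyEq_of_mem (hU.mem_nhds hz))

/-- Each iterated derivative of a holomorphic function on an open set is the derivative of the
previous one. -/
theorem DifferentiableOn.hasDerivAt_iteratedDeriv {U : Set ℂ} (hU : IsOpen U) {q : ℂ → ℂ}
    (hq : DifferentiableOn ℂ q U) (n : ℕ) {z : ℂ} (hz : z ∈ U) :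
    HasDerivAt (iteratedDeriv n q) (iteratedDeriv (n + 1) q z) z := by
  have h : DifferentiableOn ℂ (iteratedDeriv n q) U := by
    induction n with
    | zero => simpa using hq
    | succ n ih => rw [iteratedDeriv_succ]; exact ih.deriv hU
  rw [iteratedDeriv_succ]
  exact (h.differentiableAt (hU.mem_nhds hz)).hasDerivAt

/-- If `q` is holomorphic on an open set `U ⊆ ℂ \ (−∞,0]` and satisfies
`z q''' − β q'' − τ q' + q = 0` on `U`, then `Q(z) = z^{−β} q''(z)` (principal branch)
satisfies `z² Q''' + 2(β+1) z Q'' + (β² + β − τz) Q' + (z − τβ) Q = 0` on `U`. -/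
theorem ode_transformation (β τ : ℝ) (hβ : -1 < β)
    (U : Set ℂ) (hU : IsOpen U)
    (hUslit : ∀ z ∈ U, 0 < z.re ∨ z.im ≠ 0)
    (q : ℂ → ℂ) (hq : DifferentiableOn ℂ q U)
    (hode : ∀ z ∈ U,
      z * iteratedDeriv 3 q z - (β : ℂ) * iteratedDeriv 2 q z
        - (τ : ℂ) * deriv q z + q z = 0) :
    ∀ z ∈ U,
      z ^ 2 * iteratedDeriv 3 (fun w : ℂ => w ^ (-(β : ℂ)) * iteratedDeriv 2 q w) z
        + 2 * ((β : ℂ) + 1) * z *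
            iteratedDeriv 2 (fun w : ℂ => w ^ (-(β : ℂ)) * iteratedDeriv 2 q w) z
        + ((β : ℂ) ^ 2 + (β : ℂ) - (τ : ℂ) * z) *
            deriv (fun w : ℂ => w ^ (-(β : ℂ)) * iteratedDeriv 2 q w) z
        + (z - (τ : ℂ) * (β : ℂ)) * (z ^ (-(β : ℂ)) * iteratedDeriv 2 q z) = 0 := by
  have d0 : ∀ z ∈ U, HasDerivAt q (deriv q z) z := fun z hz => by
    simpa using hq.hasDerivAt_iteratedDeriv hU 0 hz
  have d1 : ∀ z ∈ U, HasDerivAt (deriv q) (iteratedDeriv 2 q z) z := fun z hz => by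
    simpa using hq.hasDerivAt_iteratedDeriv hU 1 hz
  have d2 : ∀ z ∈ U, HasDerivAt (iteratedDeriv 2 q) (iteratedDeriv 3 q z) z :=
    fun z hz => hq.hasDerivAt_iteratedDeriv hU 2 hz
  have hslit : ∀ z ∈ U, z ∈ Complex.slitPlane := hUslit
  have hne : ∀ z ∈ U, z ≠ 0 := fun z hz => Complex.slitPlane_ne_zero (hslit z hz)
  have hq3 : ∀ z ∈ U, iteratedDeriv 3 q z
      = ((β : ℂ) * iteratedDeriv 2 q z + (τ : ℂ) * deriv q z - q z) / z := fun z hz => by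
    rw [eq_div_iff (hne z hz)]
    linear_combination hode z hz
  set Q : ℂ → ℂ := fun w => w ^ (-(β : ℂ)) * iteratedDeriv 2 q w
  have hQ1 : Set.EqOn (deriv Q)
      (fun w => w ^ (-(β : ℂ)) * (((τ : ℂ) * deriv q w - q w) / w)) U := fun z hz => by
    have hz0 := hne z hz
    refine (hasDerivAt_cpow_const_mul (hslit z hz) (d2 z hz)).deriv.trans ?_
    rw [hq3 z hz]
    field_simp
    ring
  have hQ2 : Set.EqOn (iteratedDeriv 2 Q)
      (fun w => w ^ (-(β : ℂ)) * ((-((β : ℂ) + 1) * ((τ : ℂ) * deriv q w - q w)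
        + w * ((τ : ℂ) * iteratedDeriv 2 q w - deriv q w)) / w ^ 2)) U := fun z hz => by
    have hz0 := hne z hz
    rw [iteratedDeriv_succ, iteratedDeriv_one]
    refine (hU.hasDerivAt_congr hQ1 hz (hasDerivAt_cpow_const_mul (hslit z hz)
      ((((d1 z hz).const_mul (τ : ℂ)).sub (d0 z hz)).div (hasDerivAt_id z) hz0))).deriv.trans ?_
    simp only [Pi.sub_apply]
    field_simp
    ring
  intro z hz
  have hz0 := hne z hz
  have hQ3 := (hU.hasDerivAt_congr hQ2 hz (hasDerivAt_cpow_const_mul (hslit z hz)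
    ((((((d1 z hz).const_mul (τ : ℂ)).sub (d0 z hz)).const_mul (-((β : ℂ) + 1))).add
      ((hasDerivAt_id z).mul (((d2 z hz).const_mul (τ : ℂ)).sub (d1 z hz)))).div
        ((hasDerivAt_id z).pow 2) (pow_ne_zero 2 hz0)))).deriv
  rw [← iteratedDeriv_succ] at hQ3
  rw [hQ3, hQ2 hz, hQ1 hz, hq3 z hz]
  simp only [id, Pi.sub_apply, Pi.add_apply, Pi.mul_apply]
  field_simp
  ring
end

section
/- Let β > −1 and τ ∈ ℝ. For z ∈ ℂ with Re z > 0, the integral r(z) = ∫₀^∞ s^{−β−3} exp(−τ/s − 1/(2s²) − z s) ds converges absolutely, the function r is holomorphic on the open right half-plane {z : Re z > 0}, and it satisfies the differential equation z r'''(z) − β r''(z) − τ r'(z) + r(z) = 0 there. -/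
open MeasureTheory

/-- The Laplace-type kernel `s^p exp(-τ/s - 1/(2s²) - z s)`. -/
noncomputable def laplaceKernel (p τ : ℝ) (z : ℂ) (s : ℝ) : ℂ :=
  ((s ^ p : ℝ) : ℂ) * Complex.exp (-(τ : ℂ) / (s : ℂ) - 1 / (2 * (s : ℂ) ^ 2) - z * (s : ℂ))

namespace laplaceKernel

open Filter Topology Set

variable {p τ s : ℝ} {z : ℂ}

theorem norm_eq (hs : 0 < s) :
    ‖laplaceKernel p τ z s‖ =
      Real.exp (p * Real.log s + (-τ / s - 1 / (2 * s ^ 2) - z.re * s)) := by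
  have h : (-(τ : ℂ) / (s : ℂ) - 1 / (2 * (s : ℂ) ^ 2) - z * (s : ℂ)).re =
      -τ / s - 1 / (2 * s ^ 2) - z.re * s := by
    have : (-(τ : ℂ) / (s : ℂ) - 1 / (2 * (s : ℂ) ^ 2) - z * (s : ℂ)) =
        ((-τ / s - 1 / (2 * s ^ 2) : ℝ) : ℂ) - z * (s : ℂ) := by push_cast; ring
    rw [this, Complex.sub_re, Complex.ofReal_re, Complex.re_mul_ofReal]
  rw [laplaceKernel, norm_mul, Complex.norm_exp, h, Complex.norm_real, Real.norm_eq_abs,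
    abs_of_pos (Real.rpow_pos_of_pos hs p), Real.rpow_def_of_pos hs, Real.exp_add, mul_comm p]

theorem exists_mul_log_le (p : ℝ) {c : ℝ} (hc : 0 < c) :
    ∃ D, ∀ s, 0 < s → p * Real.log s ≤ |p| / s + c * s + D := by
  rcases le_or_gt p 0 with hp | hp
  · refine ⟨0, fun s hs => ?_⟩
    have h := Real.log_le_sub_one_of_pos (inv_pos.2 hs)
    rw [Real.log_inv] at h
    rw [abs_of_nonpos hp, div_eq_mul_inv]
    nlinarith [mul_pos hc hs]
  · refine ⟨-p * Real.log (c / p), fun s hs => ?_⟩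
    have h := Real.log_le_sub_one_of_pos (mul_pos (div_pos hc hp) hs)
    rw [Real.log_mul (div_pos hc hp).ne' hs.ne'] at h
    have h2 := mul_le_mul_of_nonneg_left h hp.le
    have h3 : p * (c / p * s - 1) = c * s - p := by field_simp
    have h4 : 0 < |p| / s := by positivity
    linarith

theorem exists_norm_le (p τ : ℝ) {c : ℝ} (hc : 0 < c) :
    ∃ C, 0 ≤ C ∧ ∀ (z : ℂ) (s : ℝ), 0 < s →
      ‖laplaceKernel p τ z s‖ ≤ C * Real.exp ((c - z.re) * s) := by
  obtain ⟨D, hD⟩ := exists_mul_log_le p hc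
  refine ⟨Real.exp (D + (|p| - τ) ^ 2 / 2), (Real.exp_pos _).le, fun z s hs => ?_⟩
  rw [norm_eq hs, ← Real.exp_add, Real.exp_le_exp]
  have h1 := hD s hs
  have h2 := sq_nonneg (s⁻¹ - (|p| - τ))
  have h3 : 1 / (2 * s ^ 2) = (s⁻¹) ^ 2 / 2 := by field_simp
  rw [h3, div_eq_mul_inv (-τ)]
  rw [div_eq_mul_inv |p|] at h1
  nlinarith

theorem continuousOn (p τ : ℝ) (z : ℂ) : ContinuousOn (laplaceKernel p τ z) (Ioi 0) := by
  intro s hs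
  have hs0 : s ≠ 0 := ne_of_gt hs
  have hc : (s : ℂ) ≠ 0 := Complex.ofReal_ne_zero.2 hs0
  have hr : ContinuousAt (fun s : ℝ => s ^ p) s := Real.continuousAt_rpow_const s p (Or.inl hs0)
  refine ContinuousAt.continuousWithinAt ?_
  unfold laplaceKernel
  fun_prop (disch := simpa using hs0)

theorem aestronglyMeasurable (p τ : ℝ) (z : ℂ) :
    AEStronglyMeasurable (laplaceKernel p τ z) (volume.restrict (Ioi 0)) :=
  (continuousOn p τ z).aestronglyMeasurable measurableSet_Ioi

theorem integrableOn (p τ : ℝ) (hz : 0 < z.re) : IntegrableOn (laplaceKernel p τ z) (Ioi 0) := by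
  obtain ⟨C, -, hC⟩ := exists_norm_le p τ (half_pos hz)
  refine Integrable.mono'
    ((integrableOn_exp_mul_Ioi (show z.re / 2 - z.re < 0 by linarith) 0).const_mul C)
    (aestronglyMeasurable p τ z) ?_
  filter_upwards [ae_restrict_mem measurableSet_Ioi] with s hs using hC z s hs

theorem add_one (hs : 0 < s) :
    laplaceKernel (p + 1) τ z s = (s : ℂ) * laplaceKernel p τ z s := by
  rw [laplaceKernel, laplaceKernel, Real.rpow_add_one hs.ne', Complex.ofReal_mul]
  ring

theorem hasDerivAt_left (hs : 0 < s) :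
    HasDerivAt (fun z => laplaceKernel p τ z s) (-laplaceKernel (p + 1) τ z s) z := by
  rw [add_one hs]
  have h := ((((hasDerivAt_id z).mul_const (s : ℂ)).const_sub
    (-(τ : ℂ) / (s : ℂ) - 1 / (2 * (s : ℂ) ^ 2))).cexp).const_mul ((s ^ p : ℝ) : ℂ)
  refine h.congr_deriv ?_
  simp only [laplaceKernel, id]
  ring

theorem hasDerivAt_integral (p τ : ℝ) (hz : 0 < z.re) :
    HasDerivAt (fun z => ∫ s in Ioi (0 : ℝ), laplaceKernel p τ z s)
      (-∫ s in Ioi (0 : ℝ), laplaceKernel (p + 1) τ z s) z := by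
  obtain ⟨C, hC0, hC⟩ := exists_norm_le (p + 1) τ (show 0 < z.re / 4 by linarith)
  have hU : {w : ℂ | z.re / 2 < w.re} ∈ 𝓝 z :=
    (isOpen_lt continuous_const Complex.continuous_re).mem_nhds (half_lt_self hz)
  have h := hasDerivAt_integral_of_dominated_loc_of_deriv_le (μ := volume.restrict (Ioi (0 : ℝ)))
    (F := laplaceKernel p τ) (F' := fun w s => -laplaceKernel (p + 1) τ w s)
    (bound := fun s => C * Real.exp (-(z.re / 4) * s)) hU
    (Eventually.of_forall fun w => aestronglyMeasurable p τ w)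
    (integrableOn p τ hz) (aestronglyMeasurable (p + 1) τ z).neg ?_
    ((integrableOn_exp_mul_Ioi (show -(z.re / 4) < 0 by linarith) 0).const_mul C) ?_
  · simpa only [integral_neg] using h.2
  · filter_upwards [ae_restrict_mem measurableSet_Ioi] with s hs w hw
    rw [norm_neg]
    refine (hC w s hs).trans ?_
    have : 0 < s := hs
    have : z.re / 2 < w.re := hw
    gcongr
    linarith
  · filter_upwards [ae_restrict_mem measurableSet_Ioi] with s hs w _ using hasDerivAt_left hs

theorem hasDerivAt_right (hs : 0 < s) :
    HasDerivAt (laplaceKernel p τ z)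
      ((p : ℂ) * laplaceKernel (p - 1) τ z s + (τ : ℂ) * laplaceKernel (p - 2) τ z s
        + laplaceKernel (p - 3) τ z s - z * laplaceKernel p τ z s) s := by
  have hc : (s : ℂ) ≠ 0 := Complex.ofReal_ne_zero.2 hs.ne'
  have e1 : laplaceKernel (p - 2) τ z s = s * laplaceKernel (p - 3) τ z s := by
    rw [← add_one hs]; congr 1; ring
  have e2 : laplaceKernel (p - 1) τ z s = s * laplaceKernel (p - 2) τ z s := by
    rw [← add_one hs]; congr 1; ring
  have e3 : laplaceKernel p τ z s = s * laplaceKernel (p - 1) τ z s := by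
    rw [← add_one hs]; congr 1; ring
  have hE : HasDerivAt (fun x : ℂ => -(τ : ℂ) / x - 1 / (2 * x ^ 2) - z * x)
      (τ / (s : ℂ) ^ 2 + 1 / (s : ℂ) ^ 3 - z) (s : ℂ) := by
    have h := (((hasDerivAt_const (s : ℂ) (-(τ : ℂ))).div (hasDerivAt_id (s : ℂ)) hc).sub
      ((hasDerivAt_const (s : ℂ) (1 : ℂ)).div (((hasDerivAt_id (s : ℂ)).pow 2).const_mul 2)
        (by simpa using hc))).sub ((hasDerivAt_id (s : ℂ)).const_mul z)
    refine h.congr_deriv ?_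
    simp only [id, Pi.pow_apply]
    field_simp
    ring
  have hP := (Real.hasDerivAt_rpow_const (p := p) (Or.inl hs.ne')).ofReal_comp
  have h := hP.mul hE.cexp.comp_ofReal
  refine h.congr_deriv ?_
  have e4 : (((p * s ^ (p - 1) : ℝ)) : ℂ) * Complex.exp
      (-(τ : ℂ) / (s : ℂ) - 1 / (2 * (s : ℂ) ^ 2) - z * (s : ℂ)) =
      p * laplaceKernel (p - 1) τ z s := by
    rw [laplaceKernel]; push_cast; ring
  have e5 : ((s ^ p : ℝ) : ℂ) * (Complex.exp
      (-(τ : ℂ) / (s : ℂ) - 1 / (2 * (s : ℂ) ^ 2) - z * (s : ℂ)) *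
      (τ / (s : ℂ) ^ 2 + 1 / (s : ℂ) ^ 3 - z)) =
      laplaceKernel p τ z s * (τ / (s : ℂ) ^ 2 + 1 / (s : ℂ) ^ 3 - z) := by
    rw [laplaceKernel]; ring
  rw [e4, e5, e3, e2, e1]
  field_simp
  ring

theorem tendsto_atTop (p τ : ℝ) (hz : 0 < z.re) :
    Tendsto (laplaceKernel p τ z) atTop (𝓝 0) := by
  obtain ⟨C, -, hC⟩ := exists_norm_le p τ (half_pos hz)
  refine squeeze_zero_norm' ((eventually_gt_atTop 0).mono fun s hs => hC z s hs) ?_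
  have h : Tendsto (fun s : ℝ => (z.re / 2 - z.re) * s) atTop atBot :=
    tendsto_id.const_mul_atTop_of_neg (by linarith)
  simpa using (Real.tendsto_exp_atBot.comp h).const_mul C

theorem tendsto_nhdsGT_zero (p τ : ℝ) (z : ℂ) :
    Tendsto (laplaceKernel p τ z) (𝓝[>] 0) (𝓝 0) := by
  obtain ⟨C, -, hC⟩ := exists_norm_le (p - 1) τ one_pos
  refine squeeze_zero_norm' (a := fun s => s * (C * Real.exp ((1 - z.re) * s))) ?_ ?_
  · filter_upwards [self_mem_nhdsWithin] with s hs
    have hs : 0 < s := hs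
    rw [show p = p - 1 + 1 by ring, add_one hs, norm_mul, Complex.norm_real, Real.norm_eq_abs,
      abs_of_pos hs]
    exact mul_le_mul_of_nonneg_left (hC z s hs) hs.le
  · have h : Continuous fun s : ℝ => s * (C * Real.exp ((1 - z.re) * s)) := by fun_prop
    simpa using (h.tendsto 0).mono_left nhdsWithin_le_nhds

theorem integral_recurrence (p τ : ℝ) (hz : 0 < z.re) :
    (p : ℂ) * (∫ s in Ioi (0 : ℝ), laplaceKernel (p - 1) τ z s)
      + (τ : ℂ) * (∫ s in Ioi (0 : ℝ), laplaceKernel (p - 2) τ z s)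
      + (∫ s in Ioi (0 : ℝ), laplaceKernel (p - 3) τ z s)
      - z * (∫ s in Ioi (0 : ℝ), laplaceKernel p τ z s) = 0 := by
  have i0 := (integrableOn p τ hz).const_mul z
  have i1 := (integrableOn (p - 1) τ hz).const_mul (p : ℂ)
  have i2 := (integrableOn (p - 2) τ hz).const_mul (τ : ℂ)
  have i3 := integrableOn (p - 3) τ hz
  have i12 : IntegrableOn (fun s => (p : ℂ) * laplaceKernel (p - 1) τ z s
      + (τ : ℂ) * laplaceKernel (p - 2) τ z s) (Ioi 0) := i1.add i2
  have i123 : IntegrableOn (fun s => (p : ℂ) * laplaceKernel (p - 1) τ z s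
      + (τ : ℂ) * laplaceKernel (p - 2) τ z s + laplaceKernel (p - 3) τ z s) (Ioi 0) := i12.add i3
  have h := integral_Ioi_deriv_mul_eq_sub (u := laplaceKernel p τ z) (v := fun _ => (1 : ℂ))
    (v' := fun _ => 0) (a := 0) (a' := 0) (b' := 0) (fun s hs => hasDerivAt_right hs)
    (fun s _ => hasDerivAt_const s 1)
    ((i123.sub i0).congr (ae_of_all _ fun s => by simp))
    (by simpa [Pi.mul_def] using tendsto_nhdsGT_zero p τ z)
    (by simpa [Pi.mul_def] using tendsto_atTop p τ hz)
  simp only [mul_one, mul_zero, add_zero, sub_zero] at h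
  rw [← h, integral_sub i123 i0, integral_add i12 i3,
    integral_add i1 i2]
  simp only [integral_const_mul]

end laplaceKernel

/-- For `β > -1`, `τ ∈ ℝ`, the integral
`r(z) = ∫₀^∞ s^{−β−3} exp(−τ/s − 1/(2s²) − z s) ds` converges absolutely for `Re z > 0`,
defines a holomorphic function on the right half-plane, and satisfies
`z r''' − β r'' − τ r' + r = 0` there. -/
theorem right_halfplane_integral_solution (β τ : ℝ) (hβ : -1 < β)
    (r : ℂ → ℂ)
    (hr : ∀ z : ℂ, r z = ∫ s in Set.Ioi (0 : ℝ),
      ((s ^ (-β - 3) : ℝ) : ℂ) *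
        Complex.exp (-(τ : ℂ) / (s : ℂ) - 1 / (2 * (s : ℂ) ^ 2) - z * (s : ℂ))) :
    (∀ z : ℂ, 0 < z.re →
      IntegrableOn (fun s : ℝ =>
        ((s ^ (-β - 3) : ℝ) : ℂ) *
          Complex.exp (-(τ : ℂ) / (s : ℂ) - 1 / (2 * (s : ℂ) ^ 2) - z * (s : ℂ)))
        (Set.Ioi (0 : ℝ))) ∧
    (∀ z : ℂ, 0 < z.re → DifferentiableAt ℂ r z) ∧
    (∀ z : ℂ, 0 < z.re →
      z * iteratedDeriv 3 r z - (β : ℂ) * iteratedDeriv 2 r z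
        - (τ : ℂ) * deriv r z + r z = 0) := by
  have hr' : r = fun z => ∫ s in Set.Ioi (0 : ℝ), laplaceKernel (-β - 3) τ z s := funext hr
  have hd : ∀ z : ℂ, 0 < z.re →
      HasDerivAt r (-∫ s in Set.Ioi (0 : ℝ), laplaceKernel (-β - 2) τ z s) z := by
    intro z hz
    have h := laplaceKernel.hasDerivAt_integral (-β - 3) τ hz
    rwa [← hr', show -β - 3 + 1 = -β - 2 by ring] at h
  have hU : ∀ z : ℂ, 0 < z.re → ∀ᶠ w in nhds z, 0 < w.re := fun z hz =>
    (isOpen_lt continuous_const Complex.continuous_re).mem_nhds hz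
  have hd2 : ∀ z : ℂ, 0 < z.re →
      HasDerivAt (deriv r) (∫ s in Set.Ioi (0 : ℝ), laplaceKernel (-β - 1) τ z s) z := by
    intro z hz
    have h := (laplaceKernel.hasDerivAt_integral (-β - 2) τ hz).neg
    rw [show -β - 2 + 1 = -β - 1 by ring, neg_neg] at h
    exact h.congr_of_eventuallyEq ((hU z hz).mono fun w hw => (hd w hw).deriv)
  have hd3 : ∀ z : ℂ, 0 < z.re →
      HasDerivAt (deriv (deriv r)) (-∫ s in Set.Ioi (0 : ℝ), laplaceKernel (-β) τ z s) z := by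
    intro z hz
    have h := laplaceKernel.hasDerivAt_integral (-β - 1) τ hz
    rw [show -β - 1 + 1 = -β by ring] at h
    exact h.congr_of_eventuallyEq ((hU z hz).mono fun w hw => (hd2 w hw).deriv)
  refine ⟨fun z hz => laplaceKernel.integrableOn (-β - 3) τ hz,
    fun z hz => (hd z hz).differentiableAt, fun z hz => ?_⟩
  have h := laplaceKernel.integral_recurrence (-β) τ hz
  rw [iteratedDeriv_succ, iteratedDeriv_succ, iteratedDeriv_one, (hd3 z hz).deriv,
    (hd2 z hz).deriv, (hd z hz).deriv, hr']
  push_cast at h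
  linear_combination h
end

section
/- Let β > −1 and τ ∈ ℝ, and let r(z) = ∫₀^∞ s^{−β−3} exp(−τ/s − 1/(2s²) − z s) ds for Re z > 0. Then r has an analytic continuation to the slit plane ℂ \ (−∞, 0]: there exists a holomorphic function F on ℂ \ (−∞, 0] such that F(z) = r(z) whenever Re z > 0. -/
open MeasureTheory

open Filter Topology Set

section LaplaceIntegral

variable {f γ : ℝ → ℂ} {S : Set ℝ} {C δ K : ℝ}

lemma integrableOn_mul_exp_of_le_re (hS : MeasurableSet S) (hS0 : S ⊆ Ioi 0)
    (hf : AEStronglyMeasurable f (volume.restrict S)) (hγ : Continuous γ)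
    (hfC : ∀ u ∈ S, ‖f u‖ ≤ C) (hδ : 0 < δ) {z : ℂ}
    (hre : ∀ u ∈ S, δ * u - K ≤ (z * γ u).re) :
    IntegrableOn (fun u => f u * Complex.exp (-z * γ u)) S := by
  have hb : IntegrableOn (fun u : ℝ => C * Real.exp K * Real.exp (-δ * u)) S :=
    ((integrableOn_exp_mul_Ioi (neg_lt_zero.2 hδ) 0).mono_set hS0).const_mul _
  refine Integrable.mono' hb (hf.mul (by fun_prop)) ?_
  filter_upwards [ae_restrict_mem hS] with u hu
  rw [norm_mul, Complex.norm_exp, mul_assoc, ← Real.exp_add]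
  have h1 := hre u hu
  have h2 := hfC u hu
  have h3 : (-z * γ u).re = -(z * γ u).re := by rw [neg_mul, Complex.neg_re]
  have h4 : 0 ≤ C := (norm_nonneg _).trans h2
  gcongr
  linarith

/-- A Laplace-type integral along a path `γ` is holomorphic at every point near which the
exponential decays uniformly. -/
lemma differentiableAt_integral_mul_exp (hS : MeasurableSet S) (hS0 : S ⊆ Ioi 0)
    (hf : AEStronglyMeasurable f (volume.restrict S)) (hγ : Continuous γ)
    (hfC : ∀ u ∈ S, ‖f u‖ ≤ C) (hγfC : ∀ u ∈ S, ‖γ u * f u‖ ≤ C) (hδ : 0 < δ) {z₀ : ℂ}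
    (hre : ∀ᶠ z in 𝓝 z₀, ∀ u ∈ S, δ * u - K ≤ (z * γ u).re) :
    DifferentiableAt ℂ (fun z => ∫ u in S, f u * Complex.exp (-z * γ u)) z₀ := by
  have hb : IntegrableOn (fun u : ℝ => C * Real.exp K * Real.exp (-δ * u)) S :=
    ((integrableOn_exp_mul_Ioi (neg_lt_zero.2 hδ) 0).mono_set hS0).const_mul _
  refine (hasDerivAt_integral_of_dominated_loc_of_deriv_le (μ := volume.restrict S)
    (F := fun z u => f u * Complex.exp (-z * γ u))
    (F' := fun z u => f u * (Complex.exp (-z * γ u) * (-1 * γ u))) hre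
    (Eventually.of_forall fun z => hf.mul (by fun_prop))
    (integrableOn_mul_exp_of_le_re hS hS0 hf hγ hfC hδ hre.self_of_nhds)
    (hf.mul (by fun_prop)) ?_ hb ?_).2.differentiableAt
  · filter_upwards [ae_restrict_mem hS] with u hu z hz
    have h1 := hz u hu
    have h2 := hγfC u hu
    have h3 : (-z * γ u).re = -(z * γ u).re := by rw [neg_mul, Complex.neg_re]
    have h4 : 0 ≤ C := (norm_nonneg _).trans h2
    have h5 : f u * (Complex.exp (-z * γ u) * (-1 * γ u))
        = -(γ u * f u * Complex.exp (-z * γ u)) := by ring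
    rw [h5, norm_neg, norm_mul, Complex.norm_exp, mul_assoc, ← Real.exp_add]
    gcongr
    linarith
  · refine Eventually.of_forall fun u z _ => ?_
    exact ((((hasDerivAt_id z).neg).mul_const (γ u)).cexp).const_mul (f u)

end LaplaceIntegral

lemma eventually_le_re_mul_ofReal {z₀ : ℂ} (hz₀ : 0 < z₀.re) :
    ∀ᶠ z in 𝓝 z₀, ∀ u ∈ Ioi (0 : ℝ), z₀.re / 2 * u - 0 ≤ (z * (u : ℂ)).re := by
  have h : ∀ᶠ z : ℂ in 𝓝 z₀, z₀.re / 2 < z.re :=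
    Complex.continuous_re.continuousAt.eventually_const_lt (by linarith)
  filter_upwards [h] with z hz u hu
  rw [Complex.re_mul_ofReal, sub_zero]
  exact mul_le_mul_of_nonneg_right hz.le (le_of_lt hu)

lemma eventually_le_re_mul_ofReal_Ioc (z₀ : ℂ) :
    ∀ᶠ z in 𝓝 z₀, ∀ u ∈ Ioc (0 : ℝ) 1, 1 * u - (|z₀.re| + 2) ≤ (z * (u : ℂ)).re := by
  have h : ∀ᶠ z : ℂ in 𝓝 z₀, z₀.re - 1 < z.re :=
    Complex.continuous_re.continuousAt.eventually_const_lt (by linarith)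
  filter_upwards [h] with z hz u hu
  rw [Complex.re_mul_ofReal]
  have h1 := neg_abs_le z₀.re
  have h2 := abs_nonneg z₀.re
  nlinarith [hu.1, hu.2]

lemma eventually_le_re_mul_vertical {z₀ : ℂ} {η : ℝ} (hz₀ : η * z₀.im < 0) :
    ∀ᶠ z in 𝓝 z₀, ∀ u ∈ Ioi (0 : ℝ),
      -(η * z₀.im) / 2 * u - (1 - z₀.re) ≤ (z * (1 + (η * u : ℝ) * Complex.I)).re := by
  have h : ∀ᶠ z : ℂ in 𝓝 z₀, z₀.re - 1 < z.re :=
    Complex.continuous_re.continuousAt.eventually_const_lt (by linarith)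
  have h' : ∀ᶠ z : ℂ in 𝓝 z₀, -(η * z₀.im) / 2 < -(η * z.im) :=
    Tendsto.eventually_const_lt (v := -(η * z₀.im)) (by linarith)
      (Continuous.tendsto (by fun_prop) z₀)
  filter_upwards [h, h'] with z hz hz' u hu
  have h1 : (z * (1 + (η * u : ℝ) * Complex.I)).re = z.re + -(η * z.im) * u := by
    simp; ring
  have := mul_le_mul_of_nonneg_right hz'.le (le_of_lt hu)
  rw [h1]
  linarith

/-- Rotation by a quarter turn of the ray of integration starting at `1`. -/
lemma integral_Ioi_one_eq_integral_vertical {h : ℂ → ℂ} {η C : ℝ} (hη : |η| = 1)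
    (hd : DifferentiableOn ℂ h {s | 0 < s.re})
    (hC : ∀ s : ℂ, 1 ≤ s.re → 0 ≤ η * s.im → ‖h s‖ ≤ C / ‖s‖ ^ 2)
    (hi : IntegrableOn (fun u : ℝ => h u) (Ioi 1))
    (hv : IntegrableOn (fun u : ℝ => h (1 + (η * u : ℝ) * Complex.I)) (Ioi 0)) :
    ∫ u in Ioi (1 : ℝ), h u
      = Complex.I * η * ∫ u in Ioi (0 : ℝ), h (1 + (η * u : ℝ) * Complex.I) := by
  have hηη : η * η = 1 := by rw [← abs_mul_abs_self, hη, one_mul]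
  have hC0 : 0 ≤ C := by simpa using (norm_nonneg _).trans (hC 1 (by simp) (by simp))
  have key : ∀ R : ℝ, 1 ≤ R →
      ‖(∫ u in (1 : ℝ)..R, h u)
        - Complex.I * η * ∫ u in (0 : ℝ)..R, h (1 + (η * u : ℝ) * Complex.I)‖ ≤ 2 * C / R := by
    intro R hR
    have hR0 : 0 < R := by linarith
    have hrect := Complex.integral_boundary_rect_eq_zero_of_differentiableOn h 1
      ⟨R, η * R⟩ (hd.mono fun s hs => by
        have := hs.1
        simp only [Complex.one_re, mem_preimage, uIcc_of_le hR] at this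
        exact lt_of_lt_of_le one_pos this.1)
    simp only [Complex.one_re, Complex.one_im, Complex.ofReal_zero, zero_mul, add_zero,
      smul_eq_mul, Complex.ofReal_one] at hrect
    have hsub : ∫ y in (0 : ℝ)..(η * R), h (1 + y * Complex.I)
        = η * ∫ u in (0 : ℝ)..R, h (1 + (η * u : ℝ) * Complex.I) := by
      have := intervalIntegral.smul_integral_comp_mul_left (a := 0) (b := R)
        (fun y : ℝ => h (1 + y * Complex.I)) η
      rw [mul_zero, Complex.real_smul] at this
      exact this.symm
    have hle : ∀ s : ℂ, 1 ≤ s.re → 0 ≤ η * s.im → R ≤ ‖s‖ → ‖h s‖ ≤ C / R ^ 2 := by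
      intro s h1 h2 h3
      refine (hC s h1 h2).trans ?_
      gcongr
    have htop : ‖∫ x in (1 : ℝ)..R, h (x + (η * R : ℝ) * Complex.I)‖ ≤ C / R := by
      have := intervalIntegral.norm_integral_le_of_norm_le_const (a := 1) (b := R)
        (f := fun x : ℝ => h (x + (η * R : ℝ) * Complex.I)) (C := C / R ^ 2) (by
          intro x hx
          rw [uIoc_of_le hR] at hx
          apply hle
          · simpa using hx.1.le
          · simp only [Complex.add_im, Complex.ofReal_im, Complex.im_ofReal_mul,
              Complex.I_im, mul_one, zero_add]
            rw [← mul_assoc, hηη]; linarith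
          · refine le_trans ?_ (Complex.abs_im_le_norm _)
            simp [abs_mul, hη, abs_of_pos hR0])
      refine this.trans ?_
      rw [abs_of_nonneg (by linarith), div_mul_eq_mul_div, div_le_div_iff₀ (by positivity) hR0]
      nlinarith [mul_nonneg hC0 hR0.le]
    have hright : ‖∫ y in (0 : ℝ)..(η * R), h (R + y * Complex.I)‖ ≤ C / R := by
      have := intervalIntegral.norm_integral_le_of_norm_le_const (a := 0) (b := η * R)
        (f := fun y : ℝ => h (R + y * Complex.I)) (C := C / R ^ 2) (by
          intro y hy
          apply hle
          · simpa using hR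
          · have : 0 ≤ η * y := by
              rcases mem_uIoc.1 hy with hy | hy
              · have : 0 < η := by
                  by_contra hcon
                  nlinarith [hy.1, hy.2]
                exact mul_nonneg this.le hy.1.le
              · have : η < 0 := by
                  by_contra hcon
                  nlinarith [hy.1, hy.2]
                exact mul_nonneg_of_nonpos_of_nonpos this.le hy.2
            simpa using this
          · refine le_trans ?_ (Complex.abs_re_le_norm _)
            simp [abs_of_pos hR0])
      refine this.trans (le_of_eq ?_)
      rw [sub_zero, abs_mul, hη, abs_of_pos hR0]
      field_simp
    rw [hsub] at hrect
    have heq : (∫ u in (1 : ℝ)..R, h u)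
        - Complex.I * η * ∫ u in (0 : ℝ)..R, h (1 + (η * u : ℝ) * Complex.I)
        = (∫ x in (1 : ℝ)..R, h (x + (η * R : ℝ) * Complex.I))
          - Complex.I * ∫ y in (0 : ℝ)..(η * R), h (R + y * Complex.I) := by
      linear_combination hrect
    rw [heq]
    refine (norm_sub_le _ _).trans ?_
    rw [norm_mul, Complex.norm_I, one_mul, two_mul, add_div]
    exact add_le_add htop hright
  have hlim := (intervalIntegral_tendsto_integral_Ioi 1 hi tendsto_id).sub
    ((intervalIntegral_tendsto_integral_Ioi 0 hv tendsto_id).const_mul (Complex.I * η))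
  have hzero : Tendsto (fun R : ℝ => (∫ u in (1 : ℝ)..R, h u)
      - Complex.I * η * ∫ u in (0 : ℝ)..R, h (1 + (η * u : ℝ) * Complex.I)) atTop (𝓝 0) :=
    squeeze_zero_norm' ((eventually_ge_atTop 1).mono key)
      (tendsto_const_nhds.div_atTop tendsto_id)
  exact sub_eq_zero.1 (tendsto_nhds_unique hlim hzero)

/-- The function `s ↦ s^{-β-3} exp(-τ/s - 1/(2s²))`. -/
noncomputable def laplaceDensity (β τ : ℝ) (s : ℂ) : ℂ :=
  s ^ ((-β - 3 : ℝ) : ℂ) * Complex.exp (-(τ : ℂ) / s - 1 / (2 * s ^ 2))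

lemma differentiableOn_laplaceDensity (β τ : ℝ) :
    DifferentiableOn ℂ (laplaceDensity β τ) {s | 0 < s.re} := by
  intro s hs
  have hs0 : s ≠ 0 := fun h => by simp [h] at hs
  have h2 : 2 * s ^ 2 ≠ 0 := mul_ne_zero two_ne_zero (pow_ne_zero 2 hs0)
  have h1 : s ∈ Complex.slitPlane := Or.inl hs
  unfold laplaceDensity
  have h3 : DifferentiableAt ℂ (fun s : ℂ => -(τ : ℂ) / s - 1 / (2 * s ^ 2)) s := by
    fun_prop (disch := assumption)
  exact ((differentiableAt_id.cpow_const h1).mul h3.cexp).differentiableWithinAt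

lemma norm_laplaceDensity_le {β : ℝ} (τ : ℝ) (hβ : -1 < β) {s : ℂ} (hs : 1 ≤ s.re) :
    ‖laplaceDensity β τ s‖ ≤ Real.exp (|τ| + 1) / ‖s‖ ^ 2 := by
  have hn : 1 ≤ ‖s‖ := hs.trans (Complex.re_le_norm s)
  have hs0 : s ≠ 0 := norm_pos_iff.1 (by linarith)
  have h1 : ‖s ^ ((-β - 3 : ℝ) : ℂ)‖ ≤ 1 / ‖s‖ ^ 2 := by
    rw [Complex.norm_cpow_of_ne_zero hs0]
    simp only [Complex.ofReal_re, Complex.ofReal_im, mul_zero, Real.exp_zero, div_one]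
    calc ‖s‖ ^ (-β - 3) ≤ ‖s‖ ^ (-2 : ℝ) := Real.rpow_le_rpow_of_exponent_le hn (by linarith)
      _ = 1 / ‖s‖ ^ 2 := by
        rw [Real.rpow_neg (norm_nonneg _), one_div]; norm_cast
  have h2 : ‖Complex.exp (-(τ : ℂ) / s - 1 / (2 * s ^ 2))‖ ≤ Real.exp (|τ| + 1) := by
    refine (Complex.norm_exp_le_exp_norm _).trans (Real.exp_le_exp.2 ?_)
    refine (norm_sub_le _ _).trans (add_le_add ?_ ?_)
    · rw [norm_div, norm_neg, Complex.norm_real, Real.norm_eq_abs]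
      exact div_le_self (abs_nonneg _) hn
    · rw [norm_div, norm_mul, norm_pow, norm_one, Complex.norm_ofNat]
      exact div_le_one_of_le₀ (by nlinarith) (by positivity)
  rw [laplaceDensity, norm_mul]
  calc _ ≤ 1 / ‖s‖ ^ 2 * Real.exp (|τ| + 1) := by gcongr
    _ = _ := by ring

lemma laplaceDensity_ofReal (β τ : ℝ) {s : ℝ} (hs : 0 < s) :
    laplaceDensity β τ s = ((s ^ (-β - 3) : ℝ) : ℂ) *
      Complex.exp (-(τ : ℂ) / (s : ℂ) - 1 / (2 * (s : ℂ) ^ 2)) := by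
  rw [laplaceDensity, Complex.ofReal_cpow hs.le]

lemma exists_norm_laplaceDensity_le_Ioc (β τ : ℝ) :
    ∃ C, ∀ s ∈ Ioc (0 : ℝ) 1, ‖laplaceDensity β τ s‖ ≤ C := by
  set n := ⌈β + 3⌉₊
  refine ⟨n.factorial * Real.exp ((1 - τ) ^ 2 / 2), fun s hs => ?_⟩
  have hs0 := hs.1
  have hx : 1 ≤ s⁻¹ := (one_le_inv₀ hs0).2 hs.2
  have hE : -(τ : ℂ) / (s : ℂ) - 1 / (2 * (s : ℂ) ^ 2)
      = ((-τ * s⁻¹ - (s⁻¹) ^ 2 / 2 : ℝ) : ℂ) := by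
    push_cast; ring
  rw [laplaceDensity_ofReal β τ hs0, hE, ← Complex.ofReal_exp, ← Complex.ofReal_mul,
    Complex.norm_real, Real.norm_of_nonneg (by positivity)]
  have h1 : s ^ (-β - 3) ≤ n.factorial * Real.exp s⁻¹ := by
    calc s ^ (-β - 3) = s⁻¹ ^ (β + 3) := by
          rw [Real.inv_rpow hs0.le, ← Real.rpow_neg hs0.le]; ring_nf
      _ ≤ s⁻¹ ^ (n : ℝ) := Real.rpow_le_rpow_of_exponent_le hx (Nat.le_ceil _)
      _ = s⁻¹ ^ n := Real.rpow_natCast _ _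
      _ ≤ n.factorial * Real.exp s⁻¹ := by
          have := Real.pow_div_factorial_le_exp s⁻¹ (by positivity) n
          rwa [div_le_iff₀' (by positivity)] at this
  calc _ ≤ n.factorial * Real.exp s⁻¹ * Real.exp (-τ * s⁻¹ - (s⁻¹) ^ 2 / 2) := by gcongr
    _ = n.factorial * Real.exp (s⁻¹ + (-τ * s⁻¹ - (s⁻¹) ^ 2 / 2)) := by
      rw [mul_assoc, ← Real.exp_add]
    _ ≤ _ := by
      gcongr
      nlinarith [sq_nonneg (s⁻¹ - (1 - τ))]

lemma norm_le_and_norm_mul_le {a s : ℂ} {C : ℝ} (hs : 1 ≤ ‖s‖) (h : ‖a‖ ≤ C / ‖s‖ ^ 2) :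
    ‖a‖ ≤ C ∧ ‖s * a‖ ≤ C := by
  have hs0 : 0 < ‖s‖ := by linarith
  rw [le_div_iff₀ (by positivity)] at h
  have h1 : ‖a‖ * ‖s‖ ≤ ‖a‖ * ‖s‖ ^ 2 :=
    mul_le_mul_of_nonneg_left (by nlinarith) (norm_nonneg _)
  have h2 : ‖a‖ ≤ ‖a‖ * ‖s‖ := le_mul_of_one_le_right (norm_nonneg _) hs
  refine ⟨by linarith, ?_⟩
  rw [norm_mul, mul_comm]
  linarith

lemma exists_laplaceDensity_bound {β : ℝ} (τ : ℝ) (hβ : -1 < β) :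
    ∃ C, ∀ s ∈ Ioi (0 : ℝ),
      ‖laplaceDensity β τ s‖ ≤ C ∧ ‖(s : ℂ) * laplaceDensity β τ s‖ ≤ C := by
  obtain ⟨C, hC⟩ := exists_norm_laplaceDensity_le_Ioc β τ
  refine ⟨max C (Real.exp (|τ| + 1)), fun s hs => ?_⟩
  rcases le_total s 1 with h | h
  · have h1 := hC s ⟨hs, h⟩
    refine ⟨h1.trans (le_max_left _ _), ?_⟩
    rw [norm_mul, Complex.norm_real, Real.norm_of_nonneg (le_of_lt hs)]
    exact (mul_le_of_le_one_left (norm_nonneg _) h).trans (h1.trans (le_max_left _ _))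
  · have := norm_le_and_norm_mul_le (s := (s : ℂ))
      (by rwa [Complex.norm_real, Real.norm_of_nonneg (le_of_lt hs)])
      (norm_laplaceDensity_le τ hβ (by simpa using h))
    exact ⟨this.1.trans (le_max_right _ _), this.2.trans (le_max_right _ _)⟩

lemma aestronglyMeasurable_laplaceDensity_comp (β τ : ℝ) {γ : ℝ → ℂ} (hγ : Continuous γ)
    (h : ∀ u, 0 < u → 0 < (γ u).re) :
    AEStronglyMeasurable (fun u => laplaceDensity β τ (γ u)) (volume.restrict (Ioi 0)) :=
  ((differentiableOn_laplaceDensity β τ).continuousOn.comp hγ.continuousOn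
    fun u hu => h u hu).aestronglyMeasurable measurableSet_Ioi

/-- The integral over `(0, 1]` followed by the vertical ray from `1` in direction `η I`. -/
noncomputable def bentLaplace (β τ η : ℝ) (z : ℂ) : ℂ :=
  (∫ u in Ioc (0 : ℝ) 1, laplaceDensity β τ u * Complex.exp (-z * u)) +
    Complex.I * η * ∫ u in Ioi (0 : ℝ), laplaceDensity β τ (1 + (η * u : ℝ) * Complex.I) *
      Complex.exp (-z * (1 + (η * u : ℝ) * Complex.I))

lemma laplaceDensity_vertical_bound {β : ℝ} (τ η : ℝ) (hβ : -1 < β) (u : ℝ) :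
    ‖laplaceDensity β τ (1 + (η * u : ℝ) * Complex.I)‖ ≤ Real.exp (|τ| + 1) ∧
      ‖(1 + (η * u : ℝ) * Complex.I) * laplaceDensity β τ (1 + (η * u : ℝ) * Complex.I)‖
        ≤ Real.exp (|τ| + 1) := by
  have h : (1 + (η * u : ℝ) * Complex.I : ℂ).re = 1 := by simp
  exact norm_le_and_norm_mul_le (h.symm.le.trans (Complex.re_le_norm _))
    (norm_laplaceDensity_le τ hβ h.symm.le)

lemma differentiableAt_bentLaplace {β : ℝ} (τ : ℝ) {η : ℝ} (hβ : -1 < β) {z : ℂ}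
    (hz : η * z.im < 0) : DifferentiableAt ℂ (bentLaplace β τ η) z := by
  obtain ⟨C, hC⟩ := exists_laplaceDensity_bound τ hβ
  have hsub : Ioc (0 : ℝ) 1 ⊆ Ioi 0 := Ioc_subset_Ioi_self
  refine DifferentiableAt.add ?_ (DifferentiableAt.const_mul ?_ _)
  · exact differentiableAt_integral_mul_exp measurableSet_Ioc hsub
      ((aestronglyMeasurable_laplaceDensity_comp β τ Complex.continuous_ofReal
        (by simp)).mono_set hsub) Complex.continuous_ofReal
      (fun u hu => (hC u (hsub hu)).1) (fun u hu => (hC u (hsub hu)).2) one_pos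
      (eventually_le_re_mul_ofReal_Ioc z)
  · exact differentiableAt_integral_mul_exp measurableSet_Ioi subset_rfl
      (aestronglyMeasurable_laplaceDensity_comp β τ (by fun_prop) (by simp)) (by fun_prop)
      (fun u _ => (laplaceDensity_vertical_bound τ η hβ u).1)
      (fun u _ => (laplaceDensity_vertical_bound τ η hβ u).2) (by linarith)
      (eventually_le_re_mul_vertical hz)

lemma integral_laplaceDensity_eq_bentLaplace {β : ℝ} (τ : ℝ) {η : ℝ} (hβ : -1 < β)
    (hη : |η| = 1) {z : ℂ} (hz : η * z.im < 0) (hz0 : 0 < z.re) :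
    ∫ u in Ioi (0 : ℝ), laplaceDensity β τ u * Complex.exp (-z * u) = bentLaplace β τ η z := by
  obtain ⟨C, hC⟩ := exists_laplaceDensity_bound τ hβ
  have hi : IntegrableOn (fun u : ℝ => laplaceDensity β τ u * Complex.exp (-z * u)) (Ioi 0) :=
    integrableOn_mul_exp_of_le_re measurableSet_Ioi subset_rfl
      (aestronglyMeasurable_laplaceDensity_comp β τ Complex.continuous_ofReal (by simp))
      Complex.continuous_ofReal (fun u hu => (hC u hu).1) (half_pos hz0)
      (eventually_le_re_mul_ofReal hz0).self_of_nhds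
  have hv := integrableOn_mul_exp_of_le_re measurableSet_Ioi subset_rfl
      (aestronglyMeasurable_laplaceDensity_comp β τ
        (γ := fun u => 1 + (η * u : ℝ) * Complex.I) (by fun_prop) (by simp)) (by fun_prop)
      (fun u _ => (laplaceDensity_vertical_bound τ η hβ u).1) (by linarith)
      (eventually_le_re_mul_vertical hz).self_of_nhds
  have hi1 := hi.mono_set (Ioi_subset_Ioi zero_le_one)
  have hsplit := setIntegral_union (Ioc_disjoint_Ioi (le_refl (1 : ℝ))) measurableSet_Ioi
    (hi.mono_set Ioc_subset_Ioi_self) hi1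
  rw [Ioc_union_Ioi_eq_Ioi zero_le_one] at hsplit
  rw [hsplit, bentLaplace]
  congr 1
  refine integral_Ioi_one_eq_integral_vertical
    (h := fun s => laplaceDensity β τ s * Complex.exp (-z * s)) (C := Real.exp (|τ| + 1)) hη
    ((differentiableOn_laplaceDensity β τ).mul (by fun_prop)) ?_ hi1 hv
  intro s hs hs'
  refine le_trans ?_ (norm_laplaceDensity_le τ hβ hs)
  rw [norm_mul, Complex.norm_exp]
  refine mul_le_of_le_one_right (norm_nonneg _) (Real.exp_le_one_iff.2 ?_)
  have hηη : η * η = 1 := by rw [← abs_mul_abs_self, hη, one_mul]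
  have h1 : z.im * s.im = (η * z.im) * (η * s.im) := by linear_combination (-z.im * s.im) * hηη
  have h2 : z.im * s.im ≤ 0 := h1 ▸ mul_nonpos_of_nonpos_of_nonneg hz.le hs'
  have h3 : 0 ≤ z.re * s.re := by nlinarith
  rw [neg_mul, Complex.neg_re, Complex.mul_re]
  linarith

/-- For `β > -1`, `τ ∈ ℝ`, the function
`r(z) = ∫₀^∞ s^{−β−3} exp(−τ/s − 1/(2s²) − z s) ds`, defined for `Re z > 0`, has an
analytic continuation to the slit plane `ℂ \ (−∞, 0]`. -/
theorem analytic_continuation_to_slit_plane (β τ : ℝ) (hβ : -1 < β)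
    (r : ℂ → ℂ)
    (hr : ∀ z : ℂ, 0 < z.re → r z = ∫ s in Set.Ioi (0 : ℝ),
      ((s ^ (-β - 3) : ℝ) : ℂ) *
        Complex.exp (-(τ : ℂ) / (s : ℂ) - 1 / (2 * (s : ℂ) ^ 2) - z * (s : ℂ))) :
    ∃ F : ℂ → ℂ,
      DifferentiableOn ℂ F {z : ℂ | 0 < z.re ∨ z.im ≠ 0} ∧
      ∀ z : ℂ, 0 < z.re → F z = r z := by
  have hr' : ∀ z : ℂ, 0 < z.re →
      r z = ∫ u in Ioi (0 : ℝ), laplaceDensity β τ u * Complex.exp (-z * u) := by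
    intro z hz
    rw [hr z hz]
    refine setIntegral_congr_fun measurableSet_Ioi fun s hs => ?_
    rw [laplaceDensity_ofReal β τ hs, mul_assoc, ← Complex.exp_add, neg_mul, ← sub_eq_add_neg]
  obtain ⟨C, hC⟩ := exists_laplaceDensity_bound τ hβ
  classical
  refine ⟨fun z => if 0 < z.re then r z else
    if 0 < z.im then bentLaplace β τ (-1) z else bentLaplace β τ 1 z, ?_,
    fun z hz => if_pos hz⟩
  intro z hz
  apply DifferentiableAt.differentiableWithinAt
  by_cases hre : 0 < z.re
  · refine DifferentiableAt.congr_of_eventuallyEq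
      (differentiableAt_integral_mul_exp measurableSet_Ioi subset_rfl
        (aestronglyMeasurable_laplaceDensity_comp β τ Complex.continuous_ofReal (by simp))
        Complex.continuous_ofReal (fun u hu => (hC u hu).1) (fun u hu => (hC u hu).2)
        (half_pos hre) (eventually_le_re_mul_ofReal hre)) ?_
    filter_upwards [Complex.continuous_re.continuousAt.eventually_const_lt hre] with w hw
    rw [if_pos hw, hr' w hw]
  rcases lt_or_gt_of_ne (hz.resolve_left hre) with him | him
  · refine (differentiableAt_bentLaplace τ (η := 1) hβ (by linarith)).congr_of_eventuallyEq ?_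
    filter_upwards [Complex.continuous_im.continuousAt.eventually_lt_const him] with w hw
    split_ifs with h1 h2
    · rw [hr' w h1,
        integral_laplaceDensity_eq_bentLaplace τ (η := 1) hβ (by simp) (by linarith) h1]
    · exact absurd h2 hw.not_gt
    · rfl
  · refine (differentiableAt_bentLaplace τ (η := -1) hβ (by linarith)).congr_of_eventuallyEq ?_
    filter_upwards [Complex.continuous_im.continuousAt.eventually_const_lt him] with w hw
    split_ifs with h1
    · rw [hr' w h1,
        integral_laplaceDensity_eq_bentLaplace τ (η := -1) hβ (by simp) (by linarith) h1]
    · rfl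
end

section
/- For every real a < 0, the cubic polynomial 64 w³ − 48(a+1) w² − (15a² − 78a + 15) w − (a+1)³ in the variable w has three distinct real roots; that is, there exist real numbers w₁ < w₂ < w₃, each satisfying 64 wᵢ³ − 48(a+1) wᵢ² − (15a² − 78a + 15) wᵢ − (a+1)³ = 0. -/
/-- For every real `a < 0`, the cubic
`64 w³ − 48(a+1) w² − (15a² − 78a + 15) w − (a+1)³` has three distinct real roots. -/
theorem zstar_cubic_three_real_roots (a : ℝ) (ha : a < 0) :
    ∃ w₁ w₂ w₃ : ℝ, w₁ < w₂ ∧ w₂ < w₃ ∧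
      64 * w₁ ^ 3 - 48 * (a + 1) * w₁ ^ 2 - (15 * a ^ 2 - 78 * a + 15) * w₁
        - (a + 1) ^ 3 = 0 ∧
      64 * w₂ ^ 3 - 48 * (a + 1) * w₂ ^ 2 - (15 * a ^ 2 - 78 * a + 15) * w₂
        - (a + 1) ^ 3 = 0 ∧
      64 * w₃ ^ 3 - 48 * (a + 1) * w₃ ^ 2 - (15 * a ^ 2 - 78 * a + 15) * w₃
        - (a + 1) ^ 3 = 0 := by
  -- Substituting `w = (a + 1 + 3 * (1 - a) * x) / 4` turns the equation into
  -- `4 x³ - 3 x = (1 + a) / (1 - a)`; the points below correspond to `x = -1, -1/2, 1/2, 1`.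
  set f : ℝ → ℝ := fun w ↦ 64 * w ^ 3 - 48 * (a + 1) * w ^ 2
    - (15 * a ^ 2 - 78 * a + 15) * w - (a + 1) ^ 3 with hf
  have hcont : Continuous f := by fun_prop
  have hd : 0 < (1 - a) ^ 2 := by nlinarith
  have h₁ : f (a - 1 / 2) < 0 := by
    have : f (a - 1 / 2) = -(27 / 2) * (1 - a) ^ 2 := by simp only [hf]; ring
    linarith
  have h₂ : 0 < f ((5 * a - 1) / 8) := by
    have : f ((5 * a - 1) / 8) = 27 / 2 * ((1 - a) ^ 2 * -a) := by simp only [hf]; ring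
    linarith [mul_pos hd (neg_pos.mpr ha)]
  have h₃ : f ((5 - a) / 8) < 0 := by
    have : f ((5 - a) / 8) = -(27 / 2) * (1 - a) ^ 2 := by simp only [hf]; ring
    linarith
  have h₄ : 0 < f (1 - a / 2) := by
    have : f (1 - a / 2) = 27 / 2 * ((1 - a) ^ 2 * -a) := by simp only [hf]; ring
    linarith [mul_pos hd (neg_pos.mpr ha)]
  obtain ⟨w₁, hw₁, e₁⟩ := intermediate_value_Ioo
    (show a - 1 / 2 ≤ (5 * a - 1) / 8 by linarith) hcont.continuousOn ⟨h₁, h₂⟩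
  obtain ⟨w₂, hw₂, e₂⟩ := intermediate_value_Ioo'
    (show (5 * a - 1) / 8 ≤ (5 - a) / 8 by linarith) hcont.continuousOn ⟨h₃, h₂⟩
  obtain ⟨w₃, hw₃, e₃⟩ := intermediate_value_Ioo
    (show (5 - a) / 8 ≤ 1 - a / 2 by linarith) hcont.continuousOn ⟨h₃, h₄⟩
  exact ⟨w₁, w₂, w₃, hw₁.2.trans hw₂.1, hw₂.2.trans hw₃.1, e₁, e₂, e₃⟩
end

section
/- For every real a < 0, the cubic polynomial (27a² − 46a + 27) x³ − 3(a+1)(9a² − 14a + 9) x² + 3a(11a² − 14a + 11) x − a(a+1)³ in the variable x has three distinct real roots; that is, there exist real numbers x₁ < x₂ < x₃, each satisfying (27a² − 46a + 27) xᵢ³ − 3(a+1)(9a² − 14a + 9) xᵢ² + 3a(11a² − 14a + 11) xᵢ − a(a+1)³ = 0. -/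
/-- For every real `a < 0`, the cubic
`(27a² − 46a + 27) x³ − 3(a+1)(9a² − 14a + 9) x² + 3a(11a² − 14a + 11) x − a(a+1)³`
has three distinct real roots. -/
theorem x0_cubic_three_real_roots (a : ℝ) (ha : a < 0) :
    ∃ x₁ x₂ x₃ : ℝ, x₁ < x₂ ∧ x₂ < x₃ ∧
      (27 * a ^ 2 - 46 * a + 27) * x₁ ^ 3 - 3 * (a + 1) * (9 * a ^ 2 - 14 * a + 9) * x₁ ^ 2
        + 3 * a * (11 * a ^ 2 - 14 * a + 11) * x₁ - a * (a + 1) ^ 3 = 0 ∧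
      (27 * a ^ 2 - 46 * a + 27) * x₂ ^ 3 - 3 * (a + 1) * (9 * a ^ 2 - 14 * a + 9) * x₂ ^ 2
        + 3 * a * (11 * a ^ 2 - 14 * a + 11) * x₂ - a * (a + 1) ^ 3 = 0 ∧
      (27 * a ^ 2 - 46 * a + 27) * x₃ ^ 3 - 3 * (a + 1) * (9 * a ^ 2 - 14 * a + 9) * x₃ ^ 2
        + 3 * a * (11 * a ^ 2 - 14 * a + 11) * x₃ - a * (a + 1) ^ 3 = 0 := by
  set f : ℝ → ℝ := fun x =>
    (27 * a ^ 2 - 46 * a + 27) * x ^ 3 - 3 * (a + 1) * (9 * a ^ 2 - 14 * a + 9) * x ^ 2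
      + 3 * a * (11 * a ^ 2 - 14 * a + 11) * x - a * (a + 1) ^ 3 with hf
  have hcont : Continuous f := by fun_prop
  obtain ⟨b, hb, rfl⟩ : ∃ b : ℝ, 0 < b ∧ a = -b := ⟨-a, by linarith, by ring⟩
  have hleft : f (-2 * b - 2) < 0 := by
    rw [← neg_pos]
    simp only [hf]
    ring_nf
    positivity
  have ha_pos : 0 < f (-b) := by
    have : f (-b) = b * (b + 1) ^ 3 := by
      simp only [hf]
      ring
    rw [this]
    positivity
  have hone : f 1 < 0 := by
    have : f 1 = -(b * (b + 1) ^ 3) := by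
      simp only [hf]
      ring
    rw [this, neg_lt_zero]
    positivity
  have hright : 0 < f (2 * b + 2) := by
    simp only [hf]
    ring_nf
    positivity
  obtain ⟨x₁, h₁, e₁⟩ := intermediate_value_Ioo (by linarith : -2 * b - 2 ≤ -b)
    hcont.continuousOn ⟨hleft, ha_pos⟩
  obtain ⟨x₂, h₂, e₂⟩ := intermediate_value_Ioo' (by linarith : -b ≤ 1)
    hcont.continuousOn ⟨hone, ha_pos⟩
  obtain ⟨x₃, h₃, e₃⟩ := intermediate_value_Ioo (by linarith : 1 ≤ 2 * b + 2)
    hcont.continuousOn ⟨hone, hright⟩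
  exact ⟨x₁, x₂, x₃, h₁.2.trans h₂.1, h₂.2.trans h₃.1, e₁, e₂, e₃⟩
end

section
/- Let a < 0 and let w be the middle of the three real roots of the cubic 64 w³ − 48(a+1) w² − (15a² − 78a + 15) w − (a+1)³ = 0. Assume 1 − a + a² − 2(1+a) w + w² ≠ 0 and define x = ( (1+a)³ + (6a² − 42a + 6) w − 15(1+a) w² + 8 w³ ) / ( 18 ( 1 − a + a² − 2(1+a) w + w² ) ). Then x satisfies (27a² − 46a + 27) x³ − 3(a+1)(9a² − 14a + 9) x² + 3a(11a² − 14a + 11) x − a(a+1)³ = 0. -/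
/-- If `a < 0` and `w` is the middle of the three real roots of
`64 w³ − 48(a+1) w² − (15a² − 78a + 15) w − (a+1)³ = 0`, and the denominator
`18(1 − a + a² − 2(1+a)w + w²)` is nonzero, then
`x = ((1+a)³ + (6a² − 42a + 6)w − 15(1+a)w² + 8w³) / (18(1 − a + a² − 2(1+a)w + w²))`
satisfies `(27a² − 46a + 27) x³ − 3(a+1)(9a² − 14a + 9) x² + 3a(11a² − 14a
        + 11) x − a(a+1)³ = 0`. -/
theorem x0_from_zstar (a w : ℝ) (ha : a < 0)
    (hw : 64 * w ^ 3 - 48 * (a + 1) * w ^ 2 - (15 * a ^ 2 - 78 * a + 15) * w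
      - (a + 1) ^ 3 = 0)
    (hmid : ∃ w₁ w₃ : ℝ, w₁ < w ∧ w < w₃ ∧
      64 * w₁ ^ 3 - 48 * (a + 1) * w₁ ^ 2 - (15 * a ^ 2 - 78 * a + 15) * w₁
        - (a + 1) ^ 3 = 0 ∧
      64 * w₃ ^ 3 - 48 * (a + 1) * w₃ ^ 2 - (15 * a ^ 2 - 78 * a + 15) * w₃
        - (a + 1) ^ 3 = 0)
    (hden : 1 - a + a ^ 2 - 2 * (1 + a) * w + w ^ 2 ≠ 0)
    (x : ℝ)
    (hx : x = ((1 + a) ^ 3 + (6 * a ^ 2 - 42 * a + 6) * w - 15 * (1 + a) * w ^ 2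
        + 8 * w ^ 3) / (18 * (1 - a + a ^ 2 - 2 * (1 + a) * w + w ^ 2))) :
    (27 * a ^ 2 - 46 * a + 27) * x ^ 3
      - 3 * (a + 1) * (9 * a ^ 2 - 14 * a + 9) * x ^ 2
      + 3 * a * (11 * a ^ 2 - 14 * a + 11) * x - a * (a + 1) ^ 3 = 0 := by
  have hx' : x * (18 * (1 - a + a ^ 2 - 2 * (1 + a) * w + w ^ 2))
      = (1 + a) ^ 3 + (6 * a ^ 2 - 42 * a + 6) * w - 15 * (1 + a) * w ^ 2 + 8 * w ^ 3 := by
    rw [hx, div_mul_cancel₀ _ (mul_ne_zero (by norm_num) hden)]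
  set D := 18 * (1 - a + a ^ 2 - 2 * (1 + a) * w + w ^ 2) with hD
  set N := (1 + a) ^ 3 + (6 * a ^ 2 - 42 * a + 6) * w - 15 * (1 + a) * w ^ 2 + 8 * w ^ 3 with hN
  have hD0 : D ≠ 0 := mul_ne_zero (by norm_num) hden
  have key : (27 * a ^ 2 - 46 * a + 27) * N ^ 3
      - 3 * (a + 1) * (9 * a ^ 2 - 14 * a + 9) * N ^ 2 * D
      + 3 * a * (11 * a ^ 2 - 14 * a + 11) * N * D ^ 2 - a * (a + 1) ^ 3 * D ^ 3 = 0 := by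
    rw [hN, hD]
    linear_combination
      ((459 - 4274 * a + 17016 * a ^ 2 - 34842 * a ^ 3 + 44282 * a ^ 4 - 34842 * a ^ 5
        + 17016 * a ^ 6 - 4274 * a ^ 7 + 459 * a ^ 8)
      + (-2511 + 13719 * a - 28011 * a ^ 2 + 13503 * a ^ 3 + 13503 * a ^ 4 - 28011 * a ^ 5
        + 13719 * a ^ 6 - 2511 * a ^ 7) * w
      + (5670 - 15420 * a + 17214 * a ^ 2 + 792 * a ^ 3 + 17214 * a ^ 4 - 15420 * a ^ 5
        + 5670 * a ^ 6) * w ^ 2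
      + (-6750 + 7054 * a - 8268 * a ^ 2 - 8268 * a ^ 3 + 7054 * a ^ 4 - 6750 * a ^ 5) * w ^ 3
      + (4455 - 1722 * a + 822 * a ^ 2 - 1722 * a ^ 3 + 4455 * a ^ 4) * w ^ 4
      + (-1539 + 1011 * a + 1011 * a ^ 2 - 1539 * a ^ 3) * w ^ 5
      + (216 - 368 * a + 216 * a ^ 2) * w ^ 6) * hw
  refine (mul_eq_zero.mp ?_).resolve_right (pow_ne_zero 3 hD0)
  rw [← hx'] at key
  linear_combination key
end

section
/- Let α, β, γ > −1, set s = α + β + γ, and let τ ∈ ℝ. For natural numbers n with n > 2τ² define Gₙ = (1 − √2 τ n^{−1/2})ⁿ · Γ(n+β+1) Γ(2n+s+1) / ( Γ(β+1) Γ(3n+s+1) ), and define Mₙ = (2π/Γ(1+β)) · (3π)^{−1/2} · (2/3)^{s} · e^{−τ²} · n^{β+1/2} · e^{−√2 τ n^{1/2}} · (4/27)ⁿ. Then there exist C > 0 and N such that for all n ≥ N, | Gₙ/Mₙ − 1 | ≤ C n^{−1/2}; i.e., Gₙ = Mₙ (1 + O(n^{−1/2})) as n → ∞. -/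
open Filter Asymptotics Topology

theorem log_stirlingSeq_sub_isBigO :
    (fun n : ℕ => Real.log (Stirling.stirlingSeq n) - Real.log Real.pi / 2)
      =O[atTop] fun n : ℕ => (n : ℝ)⁻¹ := by
  have hmono : Monotone fun n : ℕ =>
      Real.log (Stirling.stirlingSeq (n + 1)) - (1 / 12) * ((n : ℝ) + 1)⁻¹ := by
    refine monotone_nat_of_le_succ fun n => ?_
    have h := Stirling.log_stirlingSeq_sdiff_le (n + 1)
    have h2 : 1 / (12 * ((n : ℝ) + 1) * (n + 1 + 1))
        = (1 / 12) * ((n : ℝ) + 1)⁻¹ - (1 / 12) * ((n : ℝ) + 1 + 1)⁻¹ := by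
      field_simp
      ring
    push_cast at h ⊢
    linarith
  have hlog : Tendsto (fun n : ℕ => Real.log (Stirling.stirlingSeq (n + 1))) atTop
      (𝓝 (Real.log Real.pi / 2)) := by
    rw [← Real.log_sqrt Real.pi_pos.le]
    exact ((tendsto_add_atTop_iff_nat 1).2 Stirling.tendsto_stirlingSeq_sqrt_pi).log
      (Real.sqrt_pos.2 Real.pi_pos).ne'
  have hinv : Tendsto (fun n : ℕ => (1 / 12) * ((n : ℝ) + 1)⁻¹) atTop (𝓝 0) := by
    simpa using (tendsto_one_div_add_atTop_nhds_zero_nat (𝕜 := ℝ)).const_mul (1 / 12 : ℝ)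
  have hlim := hlog.sub hinv
  rw [sub_zero] at hlim
  refine IsBigO.of_bound (1 / 12) ?_
  filter_upwards [eventually_ge_atTop 1] with n hn
  obtain ⟨k, rfl⟩ := Nat.exists_eq_add_of_le' hn
  have hub := hmono.ge_of_tendsto hlim k
  have hlb := Stirling.log_stirlingSeq'_antitone.le_of_tendsto hlog k
  simp only [Function.comp_apply, Nat.succ_eq_add_one] at hlb hub
  rw [Real.norm_of_nonneg (by linarith), Real.norm_of_nonneg (by positivity)]
  push_cast
  linarith

theorem log_natCast_add_sub_log_isBigO (c : ℝ) :
    (fun n : ℕ => Real.log (n + c) - Real.log n) =O[atTop] fun n : ℕ => (n : ℝ)⁻¹ := by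
  have ht : Tendsto (fun n : ℕ => c * (n : ℝ)⁻¹) atTop (𝓝 0) := by
    simpa using (tendsto_inv_atTop_nhds_zero_nat (𝕜 := ℝ)).const_mul c
  have hd : (fun x : ℝ => Real.log (1 + x)) =O[𝓝 0] fun x => x := by
    have h : HasDerivAt (fun x : ℝ => Real.log (1 + x)) (1 / (1 + 0)) 0 :=
      ((hasDerivAt_id (0 : ℝ)).const_add 1).log (by norm_num)
    simpa using h.isBigO_sub
  refine ((hd.comp_tendsto ht).trans (isBigO_const_mul_self c _ _)).congr' ?_ .rfl
  filter_upwards [eventually_gt_atTop 0,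
    tendsto_natCast_atTop_atTop.eventually_gt_atTop (-c)] with n hn hc
  have hn' : (0 : ℝ) < n := by exact_mod_cast hn
  rw [← Real.log_div (by linarith) hn'.ne', Function.comp_apply]
  congr 1
  field_simp

/-- The logarithmic error in `Γ(n + a + 1) ≈ n! n ^ a`. -/
noncomputable def logGammaShiftError (a : ℝ) (n : ℕ) : ℝ :=
  Real.log (Real.Gamma (n + a + 1)) - Real.log n.factorial - a * Real.log n

theorem logGammaShiftError_isBigO_of_mem_Ioc {a : ℝ} (h0 : 0 < a) (h1 : a ≤ 1) :
    logGammaShiftError a =O[atTop] fun n : ℕ => (n : ℝ)⁻¹ := by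
  refine IsBigO.trans ?_ ((log_natCast_add_sub_log_isBigO 1).const_mul_left a)
  refine IsBigO.of_bound 1 ?_
  filter_upwards [eventually_ge_atTop 1] with n hn
  have hfeq : ∀ {y : ℝ}, 0 < y →
      (Real.log ∘ Real.Gamma) (y + 1) = (Real.log ∘ Real.Gamma) y + Real.log y := by
    intro y hy
    simp only [Function.comp_apply]
    rw [Real.Gamma_add_one hy.ne', Real.log_mul hy.ne' (Real.Gamma_pos_of_pos hy).ne', add_comm]
  have hub := Real.BohrMollerup.f_add_nat_le Real.convexOn_log_Gamma hfeq n.succ_ne_zero h0 h1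
  have hlb := Real.BohrMollerup.f_add_nat_ge Real.convexOn_log_Gamma hfeq
    (Nat.succ_le_succ hn) h0
  simp only [Function.comp_apply, Nat.succ_eq_add_one, Nat.cast_add, Nat.cast_one,
    Real.Gamma_nat_eq_factorial, add_sub_cancel_right] at hub hlb
  rw [add_right_comm] at hub hlb
  have hE : 0 ≤ logGammaShiftError a n := by unfold logGammaShiftError; linarith
  rw [one_mul, Real.norm_of_nonneg hE]
  refine le_trans ?_ (le_abs_self _)
  unfold logGammaShiftError
  linarith

theorem logGammaShiftError_add_one_sub_isBigO (a : ℝ) :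
    (fun n => logGammaShiftError (a + 1) n - logGammaShiftError a n)
      =O[atTop] fun n : ℕ => (n : ℝ)⁻¹ := by
  refine (log_natCast_add_sub_log_isBigO (a + 1)).congr' ?_ .rfl
  filter_upwards [tendsto_natCast_atTop_atTop.eventually_gt_atTop (-(a + 1))] with n hn
  have h : (0 : ℝ) < n + a + 1 := by linarith
  unfold logGammaShiftError
  rw [← add_assoc (n : ℝ) a 1, Real.Gamma_add_one h.ne',
    Real.log_mul h.ne' (Real.Gamma_pos_of_pos h).ne']
  ring

theorem logGammaShiftError_isBigO (a : ℝ) :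
    logGammaShiftError a =O[atTop] fun n : ℕ => (n : ℝ)⁻¹ := by
  have hstep : ∀ b : ℝ, (logGammaShiftError (b + 1) =O[atTop] fun n : ℕ => (n : ℝ)⁻¹) ↔
      logGammaShiftError b =O[atTop] fun n : ℕ => (n : ℝ)⁻¹ := fun b =>
    ⟨fun h => (h.sub (logGammaShiftError_add_one_sub_isBigO b)).congr_left fun n => by ring,
      fun h => (h.add (logGammaShiftError_add_one_sub_isBigO b)).congr_left fun n => by ring⟩
  obtain ⟨k, hk, -⟩ := existsUnique_add_zsmul_mem_Ioc (zero_lt_one' ℝ) a 0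
  have hbase := logGammaShiftError_isBigO_of_mem_Ioc hk.1 (by simpa using hk.2)
  rw [zsmul_one] at hbase
  clear hk
  revert hbase
  induction k using Int.induction_on with
  | zero => simp
  | succ i ih =>
    intro h
    refine ih ((hstep _).1 ?_)
    push_cast at h
    rwa [add_assoc]
  | pred i ih =>
    intro h
    refine ih ?_
    have h' := (hstep _).2 h
    push_cast at h' ⊢
    rwa [add_assoc, sub_add_cancel] at h'

/-- **Stirling's formula** for `log Γ(n + a + 1)` with an `O(1 / n)` error. -/
theorem log_Gamma_natCast_add_isBigO (a : ℝ) :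
    (fun n : ℕ => Real.log (Real.Gamma (n + a + 1)) -
      (n * Real.log n - n + (a + 1 / 2) * Real.log n + Real.log (2 * Real.pi) / 2))
      =O[atTop] fun n : ℕ => (n : ℝ)⁻¹ := by
  refine ((logGammaShiftError_isBigO a).add log_stirlingSeq_sub_isBigO).congr' ?_ .rfl
  filter_upwards [eventually_gt_atTop 0] with n hn
  have hn' : (n : ℝ) ≠ 0 := by positivity
  rw [Stirling.log_stirlingSeq_formula, Real.log_mul two_ne_zero hn',
    Real.log_mul two_ne_zero Real.pi_ne_zero, Real.log_div hn' (Real.exp_ne_zero 1), Real.log_exp]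
  unfold logGammaShiftError
  ring

theorem mul_log_one_sub_div_sqrt_isBigO (x : ℝ) :
    (fun n : ℕ => n * Real.log (1 - x / √n) + x * √n + x ^ 2 / 2)
      =O[atTop] fun n : ℕ => (√n)⁻¹ := by
  refine IsBigO.of_bound (2 * |x| ^ 3) ?_
  have hsqrt : Tendsto (fun n : ℕ => √(n : ℝ)) atTop atTop :=
    Real.tendsto_sqrt_atTop.comp tendsto_natCast_atTop_atTop
  filter_upwards [hsqrt.eventually_gt_atTop 0, hsqrt.eventually_ge_atTop (2 * |x|)] with n h0 hx
  set r := √(n : ℝ) with hr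
  have hn : (n : ℝ) = r ^ 2 := (Real.sq_sqrt n.cast_nonneg).symm
  have hu : |x / r| ≤ 1 / 2 := by
    rw [abs_div, abs_of_pos h0, div_le_iff₀ h0]
    linarith
  have h := Real.abs_log_sub_add_sum_range_le (x := x / r) (by linarith) 2
  have hb : |x / r| ^ (2 + 1) / (1 - |x / r|) ≤ 2 * |x / r| ^ 3 := by
    rw [div_le_iff₀ (by linarith)]
    nlinarith [pow_nonneg (abs_nonneg (x / r)) 3]
  have heq : n * Real.log (1 - x / r) + x * r + x ^ 2 / 2 =
      r ^ 2 * (∑ i ∈ Finset.range 2, (x / r) ^ (i + 1) / (i + 1) + Real.log (1 - x / r)) := by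
    rw [hn]
    simp [Finset.sum_range_succ]
    field_simp
    ring
  rw [heq, norm_mul, Real.norm_of_nonneg (sq_nonneg r), Real.norm_of_nonneg (inv_pos.2 h0).le]
  calc _ ≤ r ^ 2 * (2 * |x / r| ^ 3) := by
        gcongr
        exact (Real.norm_eq_abs _).trans_le (h.trans hb)
    _ = _ := by
        rw [abs_div, abs_of_pos h0]
        field_simp

theorem natCast_inv_isBigO_inv_sqrt :
    (fun n : ℕ => (n : ℝ)⁻¹) =O[atTop] fun n : ℕ => (√n)⁻¹ := by
  refine IsBigO.of_bound 1 ?_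
  filter_upwards [eventually_ge_atTop 1] with n hn
  have hn' : (1 : ℝ) ≤ n := by exact_mod_cast hn
  rw [one_mul, Real.norm_of_nonneg (by positivity), Real.norm_of_nonneg (by positivity)]
  gcongr
  exact Real.sqrt_le_iff.2 ⟨by positivity, by nlinarith⟩

theorem Asymptotics.IsBigO.exp_sub_one {ι : Type*} {l : Filter ι} {f g : ι → ℝ}
    (hfg : f =O[l] g) (hg : Tendsto g l (𝓝 0)) : (fun i => Real.exp (f i) - 1) =O[l] g := by
  have hd : (fun x : ℝ => Real.exp x - 1) =O[𝓝 0] fun x => x := by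
    simpa using (Real.hasDerivAt_exp 0).isBigO_sub
  exact (hd.comp_tendsto (hfg.trans_tendsto hg)).trans hfg


/-- Stirling-type asymptotics: with `s = α + β + γ`,
`Gₙ = (1 − √2 τ n^{−1/2})ⁿ Γ(n+β+1) Γ(2n+s+1) / (Γ(β+1) Γ(3n+s+1))` and
`Mₙ = (2π/Γ(1+β)) (3π)^{−1/2} (2/3)^s e^{−τ²} n^{β+1/2} e^{−√2 τ n^{1/2}} (4/27)ⁿ`
satisfy `Gₙ = Mₙ (1 + O(n^{−1/2}))`. -/
theorem stirling_asymptotics_Pnn_at_zero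
    (α β γ τ : ℝ) (hα : -1 < α) (hβ : -1 < β) (hγ : -1 < γ)
    (G M : ℕ → ℝ)
    (hG : ∀ n : ℕ, 2 * τ ^ 2 < (n : ℝ) →
      G n = (1 - Real.sqrt 2 * τ / Real.sqrt n) ^ n *
        (Real.Gamma ((n : ℝ) + β + 1) * Real.Gamma (2 * (n : ℝ) + (α + β + γ) + 1)) /
        (Real.Gamma (β + 1) * Real.Gamma (3 * (n : ℝ) + (α + β + γ) + 1)))
    (hM : ∀ n : ℕ, 2 * τ ^ 2 < (n : ℝ) →
      M n = (2 * Real.pi / Real.Gamma (1 + β)) *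
        (3 * Real.pi) ^ (-(1 : ℝ) / 2) *
        ((2 : ℝ) / 3) ^ (α + β + γ) *
        Real.exp (-τ ^ 2) *
        (n : ℝ) ^ (β + 1 / 2) *
        Real.exp (-(Real.sqrt 2) * τ * Real.sqrt n) *
        ((4 : ℝ) / 27) ^ n) :
    ∃ C : ℝ, 0 < C ∧ ∃ N : ℕ, ∀ n : ℕ, N ≤ n →
      |G n / M n - 1| ≤ C * (n : ℝ) ^ (-(1 : ℝ) / 2) := by
  set s := α + β + γ with hs
  have hinv (c : ℕ) : (fun n : ℕ => ((c * n : ℕ) : ℝ)⁻¹) =O[atTop] fun n : ℕ => (n : ℝ)⁻¹ := by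
    simp_rw [Nat.cast_mul, mul_inv]
    exact isBigO_const_mul_self _ _ _
  have hmul {c : ℕ} (hc : 0 < c) : Tendsto (fun n : ℕ => c * n) atTop atTop :=
    tendsto_id.const_mul_atTop' hc
  have h1 := log_Gamma_natCast_add_isBigO β
  have h2 := ((log_Gamma_natCast_add_isBigO s).comp_tendsto (hmul two_pos)).trans (hinv 2)
  have h3 := ((log_Gamma_natCast_add_isBigO s).comp_tendsto (hmul three_pos)).trans (hinv 3)
  have h0 := mul_log_one_sub_div_sqrt_isBigO (√2 * τ)
  have hlog := (((h1.add h2).sub h3).trans natCast_inv_isBigO_inv_sqrt).add h0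
  have hlim : Tendsto (fun n : ℕ => (√(n : ℝ))⁻¹) atTop (𝓝 0) :=
    (Real.tendsto_sqrt_atTop.comp tendsto_natCast_atTop_atTop).inv_tendsto_atTop
  obtain ⟨C, hC, hbound⟩ := (hlog.exp_sub_one hlim).exists_pos
  refine ⟨C, hC, eventually_atTop.1 ?_⟩
  filter_upwards [hbound.bound, eventually_ge_atTop 1,
    tendsto_natCast_atTop_atTop.eventually_gt_atTop (2 * τ ^ 2)] with n hn hn1 hτ
  have hn1' : (1 : ℝ) ≤ n := by exact_mod_cast hn1
  have hn0 : (0 : ℝ) < n := by linarith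
  have hr0 : 0 < √(n : ℝ) := Real.sqrt_pos.2 hn0
  have hbase : 0 < 1 - √2 * τ / √n := by
    rw [sub_pos, div_lt_one hr0]
    refine lt_of_abs_lt (abs_lt_of_sq_lt_sq ?_ hr0.le)
    rwa [mul_pow, Real.sq_sqrt zero_le_two, Real.sq_sqrt hn0.le]
  have hΓ1 : 0 < Real.Gamma (n + β + 1) := Real.Gamma_pos_of_pos (by linarith)
  have hΓ2 : 0 < Real.Gamma (2 * n + s + 1) := Real.Gamma_pos_of_pos (by linarith)
  have hΓ3 : 0 < Real.Gamma (3 * n + s + 1) := Real.Gamma_pos_of_pos (by linarith)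
  have hΓβ : 0 < Real.Gamma (β + 1) := Real.Gamma_pos_of_pos (by linarith)
  have hGpos : 0 < G n := by rw [hG n hτ]; positivity
  have hMpos : 0 < M n := by rw [hM n hτ, add_comm 1 β]; positivity
  have hsq : (√2 * τ) ^ 2 = 2 * τ ^ 2 := by rw [mul_pow, Real.sq_sqrt zero_le_two]
  have hlogG : Real.log (G n) = n * Real.log (1 - √2 * τ / √n) +
      (Real.log (Real.Gamma (n + β + 1)) + Real.log (Real.Gamma (2 * n + s + 1))) -
      (Real.log (Real.Gamma (β + 1)) + Real.log (Real.Gamma (3 * n + s + 1))) := by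
    rw [hG n hτ, Real.log_div (by positivity) (by positivity),
      Real.log_mul (by positivity) (by positivity), Real.log_pow,
      Real.log_mul hΓ1.ne' hΓ2.ne', Real.log_mul hΓβ.ne' hΓ3.ne']
  have hlogM : Real.log (M n) =
      Real.log 2 + Real.log Real.pi - Real.log (Real.Gamma (β + 1)) -
      (Real.log 3 + Real.log Real.pi) / 2 + s * (Real.log 2 - Real.log 3) - τ ^ 2 +
      (β + 1 / 2) * Real.log n - √2 * τ * √n + n * (2 * Real.log 2 - 3 * Real.log 3) := by
    have h4 : Real.log 4 = 2 * Real.log 2 := by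
      rw [show (4 : ℝ) = 2 ^ 2 by norm_num, Real.log_pow]; norm_num
    have h27 : Real.log 27 = 3 * Real.log 3 := by
      rw [show (27 : ℝ) = 3 ^ 3 by norm_num, Real.log_pow]; norm_num
    have hπ := Real.pi_pos
    rw [hM n hτ, add_comm 1 β,
      Real.log_mul (by positivity) (by positivity), Real.log_mul (by positivity) (by positivity),
      Real.log_mul (by positivity) (by positivity), Real.log_mul (by positivity) (by positivity),
      Real.log_mul (by positivity) (by positivity), Real.log_mul (by positivity) (by positivity),
      Real.log_div (by positivity) hΓβ.ne', Real.log_mul two_ne_zero hπ.ne',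
      Real.log_rpow (by positivity), Real.log_mul three_ne_zero hπ.ne',
      Real.log_rpow (by positivity), Real.log_div two_ne_zero three_ne_zero, Real.log_exp,
      Real.log_rpow hn0, Real.log_exp, Real.log_pow, Real.log_div (by norm_num) (by norm_num),
      h4, h27]
    ring
  have hratio : G n / M n = Real.exp (Real.log (G n) - Real.log (M n)) := by
    rw [Real.exp_sub, Real.exp_log hGpos, Real.exp_log hMpos]
  have hpow : (n : ℝ) ^ (-(1 : ℝ) / 2) = (√n)⁻¹ := by
    rw [neg_div, Real.rpow_neg hn0.le, Real.sqrt_eq_rpow]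
  rw [hratio, hpow]
  rw [Real.norm_eq_abs, Real.norm_of_nonneg (inv_pos.2 hr0).le] at hn
  convert hn using 4
  rw [hlogG, hlogM, hsq]
  simp only [Function.comp_apply, Nat.cast_mul, Nat.cast_ofNat]
  rw [Real.log_mul two_ne_zero hn0.ne', Real.log_mul three_ne_zero hn0.ne',
    Real.log_mul two_ne_zero Real.pi_ne_zero]
  ring
end

section
/- There exist positive constants δ and C with the following property. For every real a with 0 < |a+1| < δ, let z*(a) be the unique root near 0 of the cubic 64 w³ − 48(a+1) w² − (15a² − 78a + 15) w − (a+1)³ = 0 (the middle of its three real roots), and set c₀(a) = the real cube root of −z*(a)/(4a) and c₁(a) = −(2 z*(a) + a + 1)/(12 a c₀(a)). Then | c₀(a) + (2^{2/3}/12)(a+1) | ≤ C (a+1)² and | c₁(a) + 2^{1/3}/2 | ≤ C |a+1|; i.e., c₀(a) = −(2^{2/3}/12)(a+1) + O((a+1)²) and c₁(a) = −2^{1/3}/2 + O(a+1) as a → −1. -/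
/-- For `|e| < 1/100`, the middle root of the cubic lies in `[-1/2, 1/2]`. -/
lemma abs_middle_root_le {e w w₁ w₃ : ℝ} (he : |e| < 1 / 100)
    (hw : 64 * w ^ 3 - 48 * e * w ^ 2 - (15 * e ^ 2 - 108 * e + 108) * w - e ^ 3 = 0)
    (h1 : 64 * w₁ ^ 3 - 48 * e * w₁ ^ 2 - (15 * e ^ 2 - 108 * e + 108) * w₁ - e ^ 3 = 0)
    (h3 : 64 * w₃ ^ 3 - 48 * e * w₃ ^ 2 - (15 * e ^ 2 - 108 * e + 108) * w₃ - e ^ 3 = 0)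
    (hw1 : w₁ < w) (hw3 : w < w₃) : |w| ≤ 1 / 2 := by
  obtain ⟨he1, he2⟩ := abs_lt.mp he
  have he_sq : e ^ 2 ≤ 1 / 10000 := by nlinarith
  have he_cube : |e ^ 3| ≤ 1 / 10000 := by
    rw [abs_pow, pow_succ, sq_abs]
    nlinarith [abs_nonneg e, sq_nonneg e]
  obtain ⟨hc1, hc2⟩ := abs_le.mp he_cube
  have q1 : 64 * (w ^ 2 + w * w₁ + w₁ ^ 2) - 48 * e * (w + w₁)
      = 15 * e ^ 2 - 108 * e + 108 := by
    have : w - w₁ ≠ 0 := by linarith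
    apply mul_left_cancel₀ this
    linear_combination hw - h1
  have q3 : 64 * (w ^ 2 + w * w₃ + w₃ ^ 2) - 48 * e * (w + w₃)
      = 15 * e ^ 2 - 108 * e + 108 := by
    have : w - w₃ ≠ 0 := by linarith
    apply mul_left_cancel₀ this
    linear_combination hw - h3
  have bracket (h : |w| < 1) : 64 * w ^ 2 - 48 * e * w - (15 * e ^ 2 - 108 * e + 108) ≤ -40 := by
    have hsq : w ^ 2 ≤ 1 := by rw [← sq_abs]; exact pow_le_one₀ (abs_nonneg w) h.le
    have hew : |e * w| ≤ 1 / 100 * 1 := by rw [abs_mul]; gcongr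
    linarith [neg_le_of_abs_le hew, sq_nonneg e]
  rw [abs_le]
  constructor
  · by_contra! hlt
    have hw_le : w ≤ -1 := by
      by_contra! hgt
      nlinarith [bracket (abs_lt.mpr ⟨hgt, by linarith⟩)]
    nlinarith
  · by_contra! hlt
    have hw_ge : 1 ≤ w := by
      by_contra! hgt
      nlinarith [bracket (abs_lt.mpr ⟨by linarith, hgt⟩)]
    nlinarith

/-- A root `w` of the cubic in `[-1/2, 1/2]` is `e³ u` with `u = -1/108 + O(e)`. -/
lemma exists_scaled_root {e w : ℝ} (he : |e| < 1 / 100)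
    (hw : 64 * w ^ 3 - 48 * e * w ^ 2 - (15 * e ^ 2 - 108 * e + 108) * w - e ^ 3 = 0)
    (hle : |w| ≤ 1 / 2) :
    ∃ u : ℝ, w = e ^ 3 * u ∧ |u| ≤ 1 / 80 ∧ |108 * u + 1| ≤ 2 * |e| := by
  have he0 := abs_nonneg e
  have hw0 := abs_nonneg w
  set D : ℝ := 64 * w ^ 2 - 48 * e * w - (15 * e ^ 2 - 108 * e + 108) with hD
  have hew : |e * w| ≤ |e| * (1 / 2) := by rw [abs_mul]; gcongr
  have hw_sq : w ^ 2 ≤ 1 / 4 := by rw [← sq_abs]; nlinarith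
  have hDneg : D ≤ -80 := by
    have := (abs_lt.mp he).2
    have := (abs_le.mp hew).1
    nlinarith [sq_nonneg e]
  have hD0 : D ≠ 0 := by linarith
  have hu : |1 / D| ≤ 1 / 80 := by
    rw [abs_div, abs_one, abs_of_neg (by linarith : D < 0)]
    exact one_div_le_one_div_of_le (by norm_num) (by linarith)
  have hwD : w = e ^ 3 * (1 / D) := by
    field_simp
    rw [hD]
    linear_combination hw
  refine ⟨1 / D, hwD, hu, ?_⟩
  have he_sq : e ^ 2 ≤ |e| / 100 := by rw [← sq_abs]; nlinarith
  have hw_abs : |w| ≤ |e| / 80 := by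
    rw [hwD, abs_mul, abs_pow]
    have : |e| ^ 3 ≤ |e| := pow_le_of_le_one he0 (by linarith) (by norm_num)
    calc |e| ^ 3 * |1 / D| ≤ |e| * (1 / 80) := by gcongr
      _ = |e| / 80 := by ring
  have hw_sq' : w ^ 2 ≤ |e| / 160 := by rw [← sq_abs]; nlinarith
  have hnum : |D + 108| ≤ 160 * |e| := by
    obtain ⟨_, _⟩ := abs_le.mp hew
    have := le_abs_self e
    have := neg_abs_le e
    rw [abs_le]
    constructor <;> nlinarith [sq_nonneg e, sq_nonneg w]
  have : 108 * (1 / D) + 1 = (D + 108) * (1 / D) := by field_simp; ring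
  rw [this, abs_mul]
  calc |D + 108| * |1 / D| ≤ 160 * |e| * (1 / 80) := by gcongr
    _ = 2 * |e| := by ring

/-- Cube roots are Lipschitz away from zero. -/
lemma abs_sub_le_of_abs_cube_sub_le {t K r : ℝ} (hK : 1 / 75 ≤ K ^ 2)
    (h : |t ^ 3 - K ^ 3| ≤ r / 100) : |t - K| ≤ r := by
  have hq : 1 / 100 ≤ t ^ 2 + t * K + K ^ 2 := by nlinarith [sq_nonneg (2 * t + K)]
  have hf : t ^ 3 - K ^ 3 = (t - K) * (t ^ 2 + t * K + K ^ 2) := by ring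
  rw [hf, abs_mul, abs_of_pos (by linarith : 0 < t ^ 2 + t * K + K ^ 2)] at h
  nlinarith [mul_le_mul_of_nonneg_left hq (abs_nonneg (t - K))]

/-- Expansions of the coefficients `c₀(a) = (−z*(a)/(4a))^{1/3}` (real cube
root) and `c₁(a) = −(2z*(a)+a+1)/(12 a c₀(a))`, where `z*(a)` is the middle of the three
real roots of `64w³ − 48(a+1)w² − (15a² − 78a + 15)w − (a+1)³ = 0`:
`c₀(a) = −(2^{2/3}/12)(a+1) + O((a+1)²)` and `c₁(a) = −2^{1/3}/2 + O(a+1)` as `a → −1`. -/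
theorem c0_c1_expansions :
    ∃ δ C : ℝ, 0 < δ ∧ 0 < C ∧
      ∀ a : ℝ, 0 < |a + 1| → |a + 1| < δ →
        ∀ w : ℝ,
          64 * w ^ 3 - 48 * (a + 1) * w ^ 2 - (15 * a ^ 2 - 78 * a + 15) * w
            - (a + 1) ^ 3 = 0 →
          (∃ w₁ w₃ : ℝ, w₁ < w ∧ w < w₃ ∧
            64 * w₁ ^ 3 - 48 * (a + 1) * w₁ ^ 2 - (15 * a ^ 2 - 78 * a + 15) * w₁
              - (a + 1) ^ 3 = 0 ∧
            64 * w₃ ^ 3 - 48 * (a + 1) * w₃ ^ 2 - (15 * a ^ 2 - 78 * a + 15) * w₃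
              - (a + 1) ^ 3 = 0) →
          ∀ c₀ : ℝ, c₀ ^ 3 = -w / (4 * a) →
            |c₀ + (2 : ℝ) ^ ((2 : ℝ) / 3) / 12 * (a + 1)| ≤ C * (a + 1) ^ 2 ∧
            |(-(2 * w + a + 1) / (12 * a * c₀)) + (2 : ℝ) ^ ((1 : ℝ) / 3) / 2|
              ≤ C * |a + 1| := by
  refine ⟨1 / 100, 10, by norm_num, by norm_num, ?_⟩
  intro a hpos hlt w hw ⟨w₁, w₃, hw1, hw3, h1, h3⟩ c₀ hc
  obtain ⟨e, rfl⟩ : ∃ e, a = e - 1 := ⟨a + 1, by ring⟩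
  simp only [sub_add_cancel] at *
  have he : e ≠ 0 := abs_pos.mp hpos
  obtain ⟨he1, he2⟩ := abs_lt.mp hlt
  obtain ⟨u, rfl, hu, hu'⟩ := exists_scaled_root hlt (by linear_combination hw)
    (abs_middle_root_le hlt (by linear_combination hw) (by linear_combination h1)
      (by linear_combination h3) hw1 hw3)
  obtain ⟨t, rfl⟩ : ∃ t, c₀ = e * t := ⟨c₀ / e, by field_simp⟩
  set p : ℝ := (2 : ℝ) ^ ((1 : ℝ) / 3) with hp
  have hp0 : 0 < p := by positivity
  have hp3 : p ^ 3 = 2 := by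
    rw [hp, ← Real.rpow_natCast, ← Real.rpow_mul (by norm_num)]
    norm_num
  have hp2 : (2 : ℝ) ^ ((2 : ℝ) / 3) = p ^ 2 := by
    rw [hp, ← Real.rpow_natCast, ← Real.rpow_mul (by norm_num)]
    norm_num
  rw [hp2]
  have hp_lower : 5 / 4 ≤ p := by
    by_contra! h
    have := pow_lt_pow_left₀ h hp0.le (n := 3) (by norm_num)
    norm_num [hp3] at this
  have hp_upper : p ≤ 63 / 50 := by
    by_contra! h
    have := pow_lt_pow_left₀ h (by norm_num) (n := 3) (by norm_num)
    norm_num [hp3] at this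
  have hane : e - 1 ≠ 0 := by linarith
  have hane' : 1 - e ≠ 0 := by linarith
  have ht : t ^ 3 = u / (4 * (1 - e)) := by
    have : t ^ 3 = -u / (4 * (e - 1)) := by
      apply mul_left_cancel₀ (pow_ne_zero 3 he)
      rw [← mul_pow, hc]
      ring
    rw [this]
    field_simp
    ring
  have htK : |t - -(p ^ 2 / 12)| ≤ |e| := by
    apply abs_sub_le_of_abs_cube_sub_le
    · have : (-(p ^ 2 / 12)) ^ 2 = p / 72 := by linear_combination p / 144 * hp3
      rw [this]
      linarith
    · have : t ^ 3 - (-(p ^ 2 / 12)) ^ 3 = (108 * u + 1 - e) / (432 * (1 - e)) := by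
        have : (-(p ^ 2 / 12)) ^ 3 = -(1 / 432) := by
          linear_combination (-(p ^ 3 + 2) / 1728) * hp3
        rw [this, ht]
        field_simp
        ring
      rw [this, abs_div, abs_of_pos (by linarith : 0 < 432 * (1 - e)),
        div_le_iff₀ (by linarith)]
      linarith [abs_sub (108 * u + 1) e, mul_pos hpos (sub_pos.mpr he2)]
  rw [sub_neg_eq_add] at htK
  constructor
  · have : e * t + p ^ 2 / 12 * e = e * (t + p ^ 2 / 12) := by ring
    rw [this, abs_mul, ← sq_abs e]
    have := mul_le_mul_of_nonneg_left htK hpos.le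
    linarith [sq_nonneg |e|, sq |e|]
  · obtain ⟨hk1, hk2⟩ := abs_le.mp htK
    have hp_sq : (5 / 4) ^ 2 ≤ p ^ 2 := by gcongr
    have htneg : t ≤ -(23 / 200) := by linarith
    have ht0 : t ≠ 0 := by linarith
    have hden : 1 ≤ 12 * (1 - e) * -t := by
      calc (1 : ℝ) ≤ 12 * (99 / 100) * (23 / 200) := by norm_num
        _ ≤ 12 * (1 - e) * -t := by gcongr <;> linarith
    have : -(2 * (e ^ 3 * u) + (e - 1) + 1) / (12 * (e - 1) * (e * t)) + p / 2
        = -(2 * e ^ 2 * u + e + 6 * (1 - e) * p * (t + p ^ 2 / 12)) / (12 * (1 - e) * -t) := by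
      rw [div_add_div _ _ (by positivity) (by norm_num), div_eq_div_iff (by positivity)
        (by positivity)]
      linear_combination (-12 * e * t * (1 - e) ^ 2) * hp3
    rw [this, abs_div, abs_neg, abs_of_pos (by linarith : 0 < 12 * (1 - e) * -t)]
    refine (div_le_self (abs_nonneg _) hden).trans ?_
    have hfirst : |2 * e ^ 2 * u| ≤ |e| := by
      rw [abs_mul, abs_mul, abs_pow, abs_two]
      have : |e| ^ 2 ≤ |e| := pow_le_of_le_one hpos.le (by linarith) (by norm_num)
      calc 2 * |e| ^ 2 * |u| ≤ 2 * |e| * (1 / 80) := by gcongr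
        _ ≤ |e| := by linarith
    have hlast : |6 * (1 - e) * p * (t + p ^ 2 / 12)| ≤ 8 * |e| := by
      have : 0 < 1 - e := by linarith
      rw [abs_mul, abs_of_pos (by positivity)]
      have : 6 * (1 - e) * p ≤ 8 := by
        calc 6 * (1 - e) * p ≤ 6 * (101 / 100) * (63 / 50) := by gcongr; linarith
          _ ≤ 8 := by norm_num
      gcongr
    linarith [abs_add_three (2 * e ^ 2 * u) e (6 * (1 - e) * p * (t + p ^ 2 / 12))]
end
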